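/- Let P1, P2, D be affine semigroups whose semigroup algebras are Gorenstein, with interior sets int(P1) = w1 + P1, int(P2) = w2 + P2, int(D) = w + D. If π1(w1) = w = π2(w2), then the fiber product semigroup P1 ×_D P2 satisfies int(P1 ×_D P2) = (w1, w2) + (P1 ×_D P2), and hence its semigroup algebra is Gorenstein. -/

import Mathlib

open CategoryTheory

/-- Gorenstein: Noetherian with finite self-injective dimension, via vanishing of
`Ext^i(-, R)` on finitely generated modules. -/
def IsGorensteinRing (R : Type) [CommRing R] : Prop :=
  IsNoetherianRing R ∧ ∃ n : ℕ, ∀ (M : ModuleCat.{0} R), Module.Finite R M →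
    ∀ i : ℕ, n < i →
      Limits.IsZero (((Ext R (ModuleCat.{0} R) i).obj (Opposite.op M)).obj (ModuleCat.of R R))

/-- The cone of nonnegative real combinations generated by a set of vectors. -/
def realCone {E : Type*} [AddCommGroup E] [Module ℝ E] (A : Set E) : Set E :=
  {x | ∃ (N : ℕ) (c : Fin N → ℝ) (v : Fin N → E),
    (∀ i, 0 ≤ c i) ∧ (∀ i, v i ∈ A) ∧ x = ∑ i, c i • v i}

/-- The interior `int(C)` of an affine semigroup `C` in a lattice `M`, relative to an
embedding `ι` of the lattice into a real vector space: the elements of `C` mapping into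
the relative (intrinsic) interior of the real cone generated by `ι(C)`. -/
def sgInterior {M : Type*} [AddCommMonoid M] {E : Type*} [NormedAddCommGroup E]
    [NormedSpace ℝ E] (ι : M → E) (C : AddSubmonoid M) : Set M :=
  {s | s ∈ C ∧ ι s ∈ intrinsicInterior ℝ (realCone (ι '' (C : Set M)))}

/-- `Ext^i_R(N, X)` vanishes. -/
def ExtVanish (R : Type) [CommRing R] (N X : Type) [AddCommGroup N] [Module R N]
    [AddCommGroup X] [Module R X] (i : ℕ) : Prop :=
  ∀ e : Abelian.Ext (ModuleCat.of R N) (ModuleCat.of R X) i, e = 0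

namespace ExtVanish

variable {R : Type} [CommRing R] {N X Y Z : Type} [AddCommGroup N] [Module R N]
  [AddCommGroup X] [Module R X] [AddCommGroup Y] [Module R Y] [AddCommGroup Z] [Module R Z]

theorem shortExact_of_exact {f : X →ₗ[R] Y} {g : Y →ₗ[R] Z} (hf : Function.Injective f)
    (hg : Function.Surjective g) (h : Function.Exact f g) :
    (ShortComplex.mk (ModuleCat.ofHom f) (ModuleCat.ofHom g)
      (by ext x; exact h.apply_apply_eq_zero x)).ShortExact where
  exact := by
    rw [ShortComplex.ShortExact.moduleCat_exact_iff_function_exact]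
    exact h
  mono_f := (ModuleCat.mono_iff_injective _).2 hf
  epi_g := (ModuleCat.epi_iff_surjective _).2 hg

theorem of_exact_left {f : X →ₗ[R] Y} {g : Y →ₗ[R] Z} (hf : Function.Injective f)
    (hg : Function.Surjective g) (h : Function.Exact f g) {i : ℕ}
    (hY : ExtVanish R N Y (i + 1)) (hZ : ExtVanish R N Z i) : ExtVanish R N X (i + 1) := by
  intro e
  obtain ⟨x, rfl⟩ := Abelian.Ext.covariant_sequence_exact₁ (X := ModuleCat.of R N)
    (shortExact_of_exact hf hg h) e (hY _) rfl
  have hx : x = 0 := hZ x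
  rw [hx, Abelian.Ext.zero_comp]

theorem of_exact_fst {f : X →ₗ[R] Y} {g : Y →ₗ[R] Z} (hf : Function.Injective f)
    (hg : Function.Surjective g) (h : Function.Exact f g) {i : ℕ}
    (hX : ExtVanish R X N i) (hZ : ExtVanish R Z N i) : ExtVanish R Y N i := by
  intro e
  obtain ⟨x, rfl⟩ := Abelian.Ext.contravariant_sequence_exact₂ (shortExact_of_exact hf hg h)
    (ModuleCat.of R N) e (hX _)
  have hx : x = 0 := hZ x
  rw [hx, Abelian.Ext.comp_zero]

theorem congr_right (e : X ≃ₗ[R] Y) {i : ℕ} (h : ExtVanish R N X i) : ExtVanish R N Y i := by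
  intro y
  have h1 : y = (y.comp (Abelian.Ext.mk₀ (ModuleCat.ofHom e.symm.toLinearMap)) (add_zero i)).comp
      (Abelian.Ext.mk₀ (ModuleCat.ofHom e.toLinearMap)) (add_zero i) := by
    rw [Abelian.Ext.comp_assoc_of_second_deg_zero, Abelian.Ext.mk₀_comp_mk₀,
      ← ModuleCat.ofHom_comp]
    simp
  rw [h1, h (y.comp _ _), Abelian.Ext.zero_comp]

theorem congr_left (e : X ≃ₗ[R] Y) {i : ℕ} (h : ExtVanish R X N i) : ExtVanish R Y N i := by
  intro y
  have h1 : y = (Abelian.Ext.mk₀ (ModuleCat.ofHom e.symm.toLinearMap)).comp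
      ((Abelian.Ext.mk₀ (ModuleCat.ofHom e.toLinearMap)).comp y (zero_add i)) (zero_add i) := by
    rw [← Abelian.Ext.comp_assoc_of_second_deg_zero, Abelian.Ext.mk₀_comp_mk₀,
      ← ModuleCat.ofHom_comp]
    simp
  rw [h1, h (Abelian.Ext.comp _ _ _), Abelian.Ext.comp_zero]

theorem pi {ι : Type} [Finite ι] {X : ι → Type} [∀ i, AddCommGroup (X i)] [∀ i, Module R (X i)]
    {n : ℕ} (h : ∀ i, ExtVanish R N (X i) n) : ExtVanish R N (∀ i, X i) n := by
  classical
  have := Fintype.ofFinite ι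
  intro e
  have h1 : e = ∑ i, (e.comp (Abelian.Ext.mk₀ (ModuleCat.ofHom (LinearMap.proj (R := R) (φ := X) i)))
      (add_zero n)).comp (Abelian.Ext.mk₀ (ModuleCat.ofHom (LinearMap.single R X i)))
      (add_zero n) := by
    simp_rw [Abelian.Ext.comp_assoc_of_second_deg_zero, Abelian.Ext.mk₀_comp_mk₀,
      ← ModuleCat.ofHom_comp]
    rw [← Abelian.Ext.comp_sum, ← Abelian.Ext.mk₀_sum]
    have h2 : ∑ i, ModuleCat.ofHom (LinearMap.single R X i ∘ₗ LinearMap.proj (R := R) (φ := X) i)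
        = 𝟙 (ModuleCat.of R (∀ i, X i)) := by
      ext x j
      simp [ModuleCat.hom_sum, Finset.sum_apply]
    rw [h2, Abelian.Ext.comp_mk₀_id]
  rw [h1]
  refine Finset.sum_eq_zero fun i _ => ?_
  rw [h i (e.comp _ _), Abelian.Ext.zero_comp]

theorem prod {n : ℕ} (hX : ExtVanish R N X n) (hY : ExtVanish R N Y n) :
    ExtVanish R N (X × Y) n := by
  intro e
  have h1 : e = (e.comp (Abelian.Ext.mk₀ (ModuleCat.ofHom (LinearMap.fst R X Y)))
      (add_zero n)).comp (Abelian.Ext.mk₀ (ModuleCat.ofHom (LinearMap.inl R X Y))) (add_zero n) +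
      (e.comp (Abelian.Ext.mk₀ (ModuleCat.ofHom (LinearMap.snd R X Y)))
      (add_zero n)).comp (Abelian.Ext.mk₀ (ModuleCat.ofHom (LinearMap.inr R X Y)))
        (add_zero n) := by
    simp_rw [Abelian.Ext.comp_assoc_of_second_deg_zero, Abelian.Ext.mk₀_comp_mk₀,
      ← ModuleCat.ofHom_comp]
    rw [← Abelian.Ext.comp_add, ← Abelian.Ext.mk₀_add]
    have h2 : ModuleCat.ofHom (LinearMap.inl R X Y ∘ₗ LinearMap.fst R X Y) +
        ModuleCat.ofHom (LinearMap.inr R X Y ∘ₗ LinearMap.snd R X Y)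
        = 𝟙 (ModuleCat.of R (X × Y)) := by
      ext x <;> simp
    rw [h2, Abelian.Ext.comp_mk₀_id]
  rw [h1, hX (e.comp _ _), hY (e.comp _ _)]
  simp

theorem of_bijective (r : R) (hN : ∀ x : N, r • x = 0)
    (hX : Function.Bijective fun x : X => r • x) (n : ℕ) : ExtVanish R N X n := by
  let e : X ≃ₗ[R] X := LinearEquiv.ofBijective (LinearMap.lsmul R X r) hX
  have he : ModuleCat.ofHom e.toLinearMap = r • 𝟙 (ModuleCat.of R X) := by
    ext x; rfl
  have hN' : r • 𝟙 (ModuleCat.of R N) = 0 := by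
    ext x; exact hN x
  intro y
  have h1 : y = (y.comp (Abelian.Ext.mk₀ (ModuleCat.ofHom e.toLinearMap)) (add_zero n)).comp
      (Abelian.Ext.mk₀ (ModuleCat.ofHom e.symm.toLinearMap)) (add_zero n) := by
    rw [Abelian.Ext.comp_assoc_of_second_deg_zero, Abelian.Ext.mk₀_comp_mk₀,
      ← ModuleCat.ofHom_comp]
    simp
  have h2 : r • y = 0 := by
    conv_lhs => rw [← Abelian.Ext.mk₀_id_comp y]
    rw [← Abelian.Ext.smul_comp, ← Abelian.Ext.mk₀_smul, hN', Abelian.Ext.mk₀_zero,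
      Abelian.Ext.zero_comp]
  rw [h1, he, ← Abelian.Ext.smul_eq_comp_mk₀, h2, Abelian.Ext.zero_comp]

theorem of_injective (hX : Injective (ModuleCat.of R X)) (n : ℕ) : ExtVanish R N X (n + 1) :=
  fun e => e.eq_zero_of_injective

theorem zero_of_subsingleton [Subsingleton N] (n : ℕ) : ExtVanish R N X n := by
  intro e
  have : (𝟙 (ModuleCat.of R N)) = 0 := by ext x; exact Subsingleton.elim _ _
  rw [← Abelian.Ext.mk₀_id_comp e, this, Abelian.Ext.mk₀_zero, Abelian.Ext.zero_comp]

theorem isZero_ext {M : ModuleCat.{0} R} {n : ℕ} (h : ExtVanish R M X (n + 1)) :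
    Limits.IsZero (((Ext R (ModuleCat.{0} R) (n + 1)).obj (Opposite.op M)).obj
      (ModuleCat.of R X)) := by
  let P := projectiveResolution M
  refine Limits.IsZero.of_iso ?_ (P.isoExt (n + 1) (ModuleCat.of R X))
  rw [← HomologicalComplex.exactAt_iff_isZero_homology]
  rw [HomologicalComplex.exactAt_iff' _ n (n + 1) (n + 2) (by simp) (by simp)]
  rw [ShortComplex.moduleCat_exact_iff]
  intro f hf
  have hf' : P.complex.d (n + 2) (n + 1) ≫ f = 0 := hf
  have h0 := h (P.extMk f (n + 2) rfl hf')
  rw [P.extMk_eq_zero_iff f (n + 2) rfl hf' n rfl] at h0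
  obtain ⟨g, hg⟩ := h0
  exact ⟨g, hg⟩

end ExtVanish

namespace ExtVanish

variable {R : Type} [CommRing R]

theorem exists_smul_eq {N C X : Type} [AddCommGroup N] [Module R N] [AddCommGroup C] [Module R C]
    [AddCommGroup X] [Module R X] (x : R) {g : N →ₗ[R] C}
    (hx : Function.Injective (LinearMap.lsmul R N x)) (hg : Function.Surjective g)
    (h : Function.Exact (LinearMap.lsmul R N x) g) {i : ℕ} (hC : ExtVanish R C X (i + 1))
    (e : Abelian.Ext (ModuleCat.of R N) (ModuleCat.of R X) i) :
    ∃ e' : Abelian.Ext (ModuleCat.of R N) (ModuleCat.of R X) i, x • e' = e := by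
  obtain ⟨e', he'⟩ := Abelian.Ext.contravariant_sequence_exact₁ (shortExact_of_exact hx hg h)
    (ModuleCat.of R X) e (add_comm 1 i) (hC _)
  change (Abelian.Ext.mk₀ (ModuleCat.ofHom (LinearMap.lsmul R N x))).comp e' _ = e at he'
  refine ⟨e', ?_⟩
  rw [← he']
  have hf : ModuleCat.ofHom (LinearMap.lsmul R N x) = x • 𝟙 (ModuleCat.of R N) := by
    ext y; rfl
  rw [hf, Abelian.Ext.mk₀_smul, Abelian.Ext.smul_comp, Abelian.Ext.mk₀_id_comp]

variable [IsNoetherianRing R] {X : Type} [AddCommGroup X] [Module R X]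

theorem of_annihilator_le (I : Ideal R) (i : ℕ)
    (h : ∀ q : Ideal R, q.IsPrime → I ≤ q → ExtVanish R (R ⧸ q) X i)
    (M : Type) [AddCommGroup M] [Module R M] [hM : Module.Finite R M]
    (hI : ∀ r ∈ I, ∀ m : M, r • m = 0) : ExtVanish R M X i := by
  revert hI
  induction hM using IsNoetherianRing.induction_on_isQuotientEquivQuotientPrime R with
  | subsingleton N => exact fun _ => zero_of_subsingleton i
  | quotient N p f =>
    intro hI
    refine congr_left f.symm (h p.1 p.2 fun r hr => ?_)
    have h1 := hI r hr (f.symm 1)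
    rw [← map_smul, LinearEquiv.map_eq_zero_iff] at h1
    rw [← Ideal.Quotient.eq_zero_iff_mem, ← h1, Algebra.smul_def, mul_one]
    rfl
  | exact N₁ N₂ N₃ f g hf hg hfg h₁ h₃ =>
    intro hI
    refine of_exact_fst hf hg hfg (h₁ fun r hr m => hf ?_) (h₃ fun r hr m => ?_)
    · rw [map_smul, hI r hr, map_zero]
    · obtain ⟨m, rfl⟩ := hg m
      rw [← map_smul, hI r hr, map_zero]

theorem quotient_prime [Module.Finite R X] (n : ℕ)
    (h : ∀ m : Ideal R, m.IsMaximal → ∀ i, n < i → ExtVanish R (R ⧸ m) X i)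
    (p : Ideal R) (hp : p.IsPrime) : ∀ i, n < i → ExtVanish R (R ⧸ p) X i := by
  induction p using WellFoundedGT.induction with
  | ind p ih =>
  intro i hi
  by_cases hmax : p.IsMaximal
  · exact h p hmax i hi
  have key : ∀ x : R, x ∉ p → ∀ e : Abelian.Ext (ModuleCat.of R (R ⧸ p)) (ModuleCat.of R X) i,
      ∃ e' : Abelian.Ext (ModuleCat.of R (R ⧸ p)) (ModuleCat.of R X) i, x • e' = e := by
    intro x hx
    refine exists_smul_eq x (g := (LinearMap.lsmul R (R ⧸ p) x).range.mkQ) ?_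
      (Submodule.mkQ_surjective _) (LinearMap.exact_map_mkQ_range _) ?_
    · rw [injective_iff_map_eq_zero]
      intro y hy
      obtain ⟨y, rfl⟩ := Ideal.Quotient.mk_surjective y
      have hy' : Ideal.Quotient.mk p (x * y) = 0 := hy
      rw [Ideal.Quotient.eq_zero_iff_mem] at hy' ⊢
      exact (hp.mem_or_mem hy').resolve_left hx
    · refine of_annihilator_le (p ⊔ Ideal.span {x}) (i + 1) (fun q hq hle => ?_) _ ?_
      · refine ih q (lt_of_le_of_ne (le_sup_left.trans hle) ?_) hq (i + 1) (by omega)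
        rintro rfl
        exact hx (hle (Ideal.mem_sup_right (Ideal.mem_span_singleton_self x)))
      · intro r hr m
        obtain ⟨m, rfl⟩ := Submodule.mkQ_surjective _ m
        obtain ⟨m, rfl⟩ := Ideal.Quotient.mk_surjective m
        obtain ⟨a, ha, b, hb, rfl⟩ := Submodule.mem_sup.1 hr
        obtain ⟨c, rfl⟩ := Ideal.mem_span_singleton'.1 hb
        rw [← map_smul, Submodule.mkQ_apply, Submodule.Quotient.mk_eq_zero]
        refine ⟨Ideal.Quotient.mk p (c * m), ?_⟩
        change Ideal.Quotient.mk p (x * (c * m)) = Ideal.Quotient.mk p ((a + c * x) * m)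
        rw [Ideal.Quotient.eq]
        have : x * (c * m) - (a + c * x) * m = -(a * m) := by ring
        rw [this]
        exact p.neg_mem (p.mul_mem_right m ha)
  obtain ⟨m, hm, hpm⟩ := p.exists_le_maximal hp.ne_top
  obtain ⟨x, hxm, hxp⟩ := SetLike.exists_of_lt
    (lt_of_le_of_ne hpm fun h => hmax (h ▸ hm))
  obtain ⟨r, hr, hr'⟩ := Submodule.exists_sub_one_mem_and_smul_eq_zero_of_fg_of_le_smul
    (Ideal.span {x}) (⊤ : Submodule R (Abelian.Ext (ModuleCat.of R (R ⧸ p)) (ModuleCat.of R X) i))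
    (Module.finite_def.1 inferInstance) (fun e _ => by
      obtain ⟨e', rfl⟩ := key x hxp e
      exact Submodule.smul_mem_smul (Ideal.mem_span_singleton_self x) trivial)
  have hrp : r ∉ p := fun hrp => by
    have h1 : r - 1 ∈ m := (Ideal.span_singleton_le_iff_mem m).2 hxm hr
    exact hm.ne_top ((Ideal.eq_top_iff_one m).2 (by simpa using m.sub_mem (hpm hrp) h1))
  intro e
  obtain ⟨e', rfl⟩ := key r hrp e
  exact hr' e' trivial

theorem of_maximal [Module.Finite R X] (n : ℕ)
    (h : ∀ m : Ideal R, m.IsMaximal → ∀ i, n < i → ExtVanish R (R ⧸ m) X i)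
    (M : Type) [AddCommGroup M] [Module R M] [Module.Finite R M] (i : ℕ) (hi : n < i) :
    ExtVanish R M X i :=
  of_annihilator_le ⊥ i (fun q hq _ => quotient_prime n h q hq i hi) M
    (fun r hr m => by rw [(Submodule.mem_bot R).1 hr, zero_smul])

end ExtVanish

theorem exists_sub_algebraMap_mem_of_isMaximal {R : Type} [CommRing R] [Algebra ℂ R]
    [Algebra.FiniteType ℂ R] (m : Ideal R) (hm : m.IsMaximal) (x : R) :
    ∃ c : ℂ, x - algebraMap ℂ R c ∈ m := by
  let := Ideal.Quotient.field m
  have : Module.Finite ℂ (R ⧸ m) := finite_of_finite_type_of_isJacobsonRing ℂ (R ⧸ m)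
  obtain ⟨c, hc⟩ := (IsAlgClosed.algebraMap_bijective_of_isIntegral (k := ℂ) (K := R ⧸ m)).2
    (Ideal.Quotient.mk m x)
  exact ⟨c, Ideal.Quotient.eq.1 (by rw [← hc]; rfl)⟩

theorem ExtVanish.ker_of_exact {R : Type} [CommRing R] {N : Type} [AddCommGroup N] [Module R N]
    {K : ℕ → Type} [∀ j, AddCommGroup (K j)] [∀ j, Module R (K j)]
    (d : ∀ j, K j →ₗ[R] K (j + 1)) (hd : ∀ j, Function.Exact (d j) (d (j + 1)))
    (hK : ∀ j i, ExtVanish R N (K j) (i + 1)) (n : ℕ) (hn : ∀ x : K (n + 1), x = 0)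
    (i : ℕ) : ExtVanish R N (LinearMap.ker (d 0)) (n + 1 + i) := by
  have key : ∀ k j, j + k = n + 1 → ∀ i, ExtVanish R N (LinearMap.ker (d j)) (k + i) := by
    intro k
    induction k with
    | zero =>
      rintro j rfl i
      have : Subsingleton (LinearMap.ker (d (n + 1))) :=
        ⟨fun a b => Subtype.ext ((hn a).trans (hn b).symm)⟩
      exact of_bijective (0 : R) (fun x => zero_smul R x)
        ⟨fun _ _ _ => Subsingleton.elim _ _, fun b => ⟨b, Subsingleton.elim _ _⟩⟩ _
    | succ k ih =>
      intro j hj i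
      rw [show k + 1 + i = k + i + 1 by omega]
      refine of_exact_left (f := (LinearMap.ker (d j)).subtype)
        (g := (d j).codRestrict (LinearMap.ker (d (j + 1)))
          fun x => (hd j).apply_apply_eq_zero x) (Submodule.subtype_injective _) ?_ ?_
        (hK j _) (ih (j + 1) (by omega) i)
      · rintro ⟨y, hy⟩
        obtain ⟨x, rfl⟩ := (hd j y).1 hy
        exact ⟨x, rfl⟩
      · exact fun x => ⟨fun hx => ⟨⟨x, congrArg Subtype.val hx⟩, rfl⟩,
          fun ⟨y, hy⟩ => Subtype.ext (hy ▸ y.2)⟩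
  exact key (n + 1) 0 (by omega) i

theorem ExtVanish.inf {R : Type} [CommRing R] {N M : Type} [AddCommGroup N] [Module R N]
    [AddCommGroup M] [Module R M] (W₁ W₂ : Submodule R M) {i : ℕ}
    (h₁ : ExtVanish R N W₁ (i + 1)) (h₂ : ExtVanish R N W₂ (i + 1))
    (h : ExtVanish R N ↥(W₁ ⊔ W₂) i) : ExtVanish R N ↥(W₁ ⊓ W₂) (i + 1) := by
  refine of_exact_left
    (f := (Submodule.inclusion inf_le_left).prod (Submodule.inclusion inf_le_right))
    (g := (Submodule.inclusion le_sup_left).coprod (-Submodule.inclusion le_sup_right))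
    ?_ ?_ ?_ (h₁.prod h₂) h
  · intro a b hab
    exact Subtype.ext (congrArg (fun z => (z.1 : M)) hab)
  · rintro ⟨x, hx⟩
    obtain ⟨y, hy, z, hz, rfl⟩ := Submodule.mem_sup.1 hx
    exact ⟨(⟨y, hy⟩, ⟨-z, W₂.neg_mem hz⟩), Subtype.ext (by simp)⟩
  · rintro ⟨⟨y, hy⟩, ⟨z, hz⟩⟩
    constructor
    · intro h
      have h' : y + -z = 0 := congrArg Subtype.val h
      obtain rfl : y = z := add_neg_eq_zero.1 h'
      exact ⟨⟨y, hy, hz⟩, rfl⟩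
    · rintro ⟨⟨x, hx⟩, h⟩
      obtain ⟨h1, h2⟩ := Prod.ext_iff.1 h
      have h1' : x = y := congrArg Subtype.val h1
      have h2' : x = z := congrArg Subtype.val h2
      exact Subtype.ext (by simp [← h1', ← h2'])

section

variable {Q G : Type} [AddCommMonoid Q] [AddCommGroup G]

/-- Subsets of `G` stable under subtracting elements of `Q`. -/
structure DownSet (j : Q →+ G) where
  carrier : Set G
  sub_mem : ∀ u ∈ carrier, ∀ q, u - j q ∈ carrier

namespace DownSet

variable {j : Q →+ G} (A : DownSet j)

/-- Complex functions on `G` vanishing outside a down-set. -/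
def fns : Submodule ℂ (G → ℂ) where
  carrier := {h | ∀ u, u ∉ A.carrier → h u = 0}
  add_mem' hf hg u hu := by simp [hf u hu, hg u hu]
  zero_mem' _ _ := rfl
  smul_mem' c h hh u hu := by simp [hh u hu]

/-- Complex functions on a down-set, regarded as a module over the semigroup algebra. -/
def Fn : Type := A.fns

noncomputable instance : AddCommGroup A.Fn := inferInstanceAs (AddCommGroup A.fns)

noncomputable instance : Module ℂ A.Fn := inferInstanceAs (Module ℂ A.fns)

/-- The underlying function on `G`, vanishing outside the down-set. -/
def val : A.Fn →ₗ[ℂ] (G → ℂ) := A.fns.subtype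

/-- The function on a down-set obtained by restricting a function on `G`. -/
noncomputable def restrict : (G → ℂ) →ₗ[ℂ] A.Fn where
  toFun f := (⟨A.carrier.indicator f, fun _ hu => Set.indicator_of_notMem hu f⟩ : A.fns)
  map_add' f g := Subtype.ext (Set.indicator_add A.carrier f g)
  map_smul' c f := Subtype.ext (Set.indicator_const_smul A.carrier c f)

variable {A}

theorem val_of_notMem (h : A.Fn) {u : G} (hu : u ∉ A.carrier) : A.val h u = 0 :=
  Subtype.property (p := fun h => h ∈ A.fns) h u hu

theorem val_restrict_of_mem (f : G → ℂ) {u : G} (hu : u ∈ A.carrier) :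
    A.val (A.restrict f) u = f u :=
  Set.indicator_of_mem hu f

theorem ext_fn {f g : A.Fn} (h : ∀ u ∈ A.carrier, A.val f u = A.val g u) : f = g := by
  refine Subtype.ext (funext fun u => ?_)
  by_cases hu : u ∈ A.carrier
  · exact h u hu
  · exact (val_of_notMem f hu).trans (val_of_notMem g hu).symm

variable (A)

/-- Translation of functions by elements of `Q`. -/
noncomputable def translate : Multiplicative Q →* Module.End ℂ A.Fn where
  toFun q := A.restrict ∘ₗ LinearMap.funLeft ℂ ℂ (fun u => u - j q.toAdd) ∘ₗ A.val
  map_one' := by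
    refine LinearMap.ext fun h => ext_fn fun u hu => ?_
    rw [LinearMap.comp_apply, val_restrict_of_mem _ hu]
    simp [LinearMap.funLeft_apply]
  map_mul' p q := by
    refine LinearMap.ext fun h => ext_fn fun u hu => ?_
    simp only [Module.End.mul_apply, LinearMap.comp_apply, val_restrict_of_mem _ hu,
      LinearMap.funLeft_apply, val_restrict_of_mem _ (A.sub_mem u hu _), toAdd_mul, map_add,
      sub_sub]

noncomputable instance : Module (AddMonoidAlgebra ℂ Q) A.Fn :=
  Module.compHom _ (AddMonoidAlgebra.lift ℂ (Module.End ℂ A.Fn) Q A.translate).toRingHom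

variable {A}

theorem val_single_smul (q : Q) (c : ℂ) (h : A.Fn) {u : G} (hu : u ∈ A.carrier) :
    A.val (AddMonoidAlgebra.single q c • h) u = c * A.val h (u - j q) := by
  change A.val ((AddMonoidAlgebra.lift ℂ (Module.End ℂ A.Fn) Q A.translate
    (AddMonoidAlgebra.single q c)) h) u = _
  rw [AddMonoidAlgebra.lift_single, LinearMap.smul_apply, map_smul, Pi.smul_apply, smul_eq_mul]
  congr 1
  exact val_restrict_of_mem _ hu

theorem algebraMap_smul (c : ℂ) (h : A.Fn) :
    algebraMap ℂ (AddMonoidAlgebra ℂ Q) c • h = c • h := by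
  change (AddMonoidAlgebra.lift ℂ (Module.End ℂ A.Fn) Q A.translate (algebraMap ℂ _ c)) h = _
  rw [AlgHom.commutes]
  rfl

/-- A translation-stable ideal of subsets of `G`. -/
structure Family (j : Q →+ G) where
  mem : Set G → Prop
  empty : mem ∅
  mono : ∀ S T, S ⊆ T → mem T → mem S
  union : ∀ S T, mem S → mem T → mem (S ∪ T)
  shift : ∀ S, mem S → ∀ q, mem {u | u - j q ∈ S}

variable (A)

/-- Functions with support in a given family. -/
noncomputable def fnSub (p : Family j) : Submodule (AddMonoidAlgebra ℂ Q) A.Fn where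
  carrier := {h | p.mem (Function.support (A.val h))}
  add_mem' := by
    rintro f g hf hg
    refine p.mono _ _ ?_ (p.union _ _ hf hg)
    rw [map_add]
    exact Function.support_add _ _
  zero_mem' := by
    change p.mem _
    rw [map_zero, Function.support_zero]
    exact p.empty
  smul_mem' := by
    intro r h hh
    induction r using AddMonoidAlgebra.induction_linear with
    | zero =>
      change p.mem _
      rw [zero_smul, map_zero, Function.support_zero]
      exact p.empty
    | add f g hf hg =>
      refine p.mono _ _ ?_ (p.union _ _ hf hg)
      rw [add_smul, map_add]
      exact Function.support_add _ _
    | single q c =>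
      refine p.mono _ _ ?_ (p.shift _ hh q)
      intro u hu
      by_cases huA : u ∈ A.carrier
      · rw [Function.mem_support, val_single_smul _ _ _ huA] at hu
        exact right_ne_zero_of_mul hu
      · exact absurd (val_of_notMem _ huA) hu

variable {A}

theorem bijective_smul (p : Family j) (q : Q) (χ : ℂ) (hA : ∀ u ∈ A.carrier, u + j q ∈ A.carrier)
    (hfin : ∀ S, p.mem S → ∀ u, ∃ K : ℕ, ∀ k ≥ K, u + k • j q ∉ S)
    (hstab : ∀ S, p.mem S → p.mem {u | ∃ k : ℕ, u + k • j q ∈ S}) :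
    Function.Bijective fun h : A.fnSub p =>
      (AddMonoidAlgebra.single q (1 : ℂ) - algebraMap ℂ (AddMonoidAlgebra ℂ Q) χ) • h := by
  have hval : ∀ (h : A.Fn) (u : G), u ∈ A.carrier →
      A.val ((AddMonoidAlgebra.single q (1 : ℂ) - algebraMap ℂ (AddMonoidAlgebra ℂ Q) χ) • h) u =
        A.val h (u - j q) - χ * A.val h u := by
    intro h u hu
    rw [sub_smul, map_sub, Pi.sub_apply, val_single_smul _ _ _ hu, algebraMap_smul, one_mul,
      map_smul, Pi.smul_apply, smul_eq_mul]
  constructor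
  · refine (injective_iff_map_eq_zero
      (LinearMap.lsmul (AddMonoidAlgebra ℂ Q) (A.fnSub p) _)).2 ?_
    rintro ⟨h, hh⟩ h0
    have h0' : (AddMonoidAlgebra.single q (1 : ℂ) - algebraMap ℂ (AddMonoidAlgebra ℂ Q) χ) • h = 0 :=
      congrArg Subtype.val h0
    refine Subtype.ext (ext_fn fun u hu => ?_)
    have hk : ∀ k : ℕ, u + k • j q ∈ A.carrier ∧ A.val h u = χ ^ k * A.val h (u + k • j q) := by
      intro k
      induction k with
      | zero => simp [hu]
      | succ k ih =>
        have hm : u + (k + 1) • j q ∈ A.carrier := by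
          rw [succ_nsmul, ← add_assoc]
          exact hA _ ih.1
        refine ⟨hm, ?_⟩
        have := hval h _ hm
        rw [h0', map_zero, Pi.zero_apply, succ_nsmul, ← add_assoc, add_sub_cancel_right, eq_comm,
          sub_eq_zero] at this
        rw [ih.2, this, succ_nsmul, ← add_assoc, pow_succ, mul_assoc]
    obtain ⟨K, hK⟩ := hfin _ hh u
    have := (hk K).2
    rw [Function.notMem_support.1 (hK K le_rfl), mul_zero] at this
    rw [this]
    rfl
  · rintro ⟨h, hh⟩
    choose K hK using hfin _ hh
    have hK' : ∀ u k, K u ≤ k → A.val h (u + k • j q) = 0 :=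
      fun u k hk => Function.notMem_support.1 (hK u k hk)
    let s : ℕ → G → ℂ := fun N u => ∑ k ∈ Finset.range N, χ ^ k * A.val h (u + (k + 1) • j q)
    have hs : ∀ u N, K u ≤ N → s N u = s (K u) u := by
      intro u N hN
      refine (Finset.sum_subset (Finset.range_mono hN) fun k _ hk => ?_).symm
      rw [hK' u _ (by simp at hk; omega), mul_zero]
    refine ⟨⟨A.restrict fun u => s (K u) u, ?_⟩, ?_⟩
    · refine p.mono _ _ ?_ (hstab _ hh)
      intro u hu
      by_cases huA : u ∈ A.carrier
      · rw [Function.mem_support, val_restrict_of_mem _ huA] at hu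
        obtain ⟨k, -, hk⟩ := Finset.exists_ne_zero_of_sum_ne_zero hu
        exact ⟨k + 1, right_ne_zero_of_mul hk⟩
      · exact absurd (val_of_notMem _ huA) hu
    · refine Subtype.ext (ext_fn fun u hu => ?_)
      refine (hval _ u hu).trans ?_
      rw [val_restrict_of_mem _ hu, val_restrict_of_mem _ (A.sub_mem u hu q)]
      dsimp only
      rw [← hs (u - j q) (max (K u) (K (u - j q)) + 1) (by omega),
        ← hs u (max (K u) (K (u - j q))) (by omega)]
      simp only [s]
      rw [Finset.sum_range_succ', Finset.mul_sum, add_sub_right_comm, ← Finset.sum_sub_distrib,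
        Finset.sum_eq_zero]
      · simp
      · intro k _
        rw [succ_nsmul' (j q) (k + 1), ← add_assoc, sub_add_cancel, pow_succ]
        ring

end DownSet

end

namespace DownSet

variable {Q G : Type} [AddCommMonoid Q] [AddCommGroup G] {j : Q →+ G} {A : DownSet j}

instance : IsScalarTower ℂ (AddMonoidAlgebra ℂ Q) A.Fn :=
  IsScalarTower.of_algebraMap_smul fun c h => algebraMap_smul c h

theorem baer_fn (hj : Function.Injective j) (hA : A.carrier = Set.range fun q => -j q) :
    Module.Baer (AddMonoidAlgebra ℂ Q) A.Fn := by
  intro I g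
  have h0 : (0 : G) ∈ A.carrier := hA ▸ ⟨0, by simp⟩
  let ℓ : I.restrictScalars ℂ →ₗ[ℂ] ℂ :=
    LinearMap.proj (0 : G) ∘ₗ A.val ∘ₗ g.restrictScalars ℂ
  obtain ⟨ℓ', hℓ'⟩ := ℓ.exists_extend
  let F : A.Fn := A.restrict fun u => ℓ' (AddMonoidAlgebra.single (Function.invFun j (-u)) 1)
  have hmem : ∀ q, -j q ∈ A.carrier := fun q => hA ▸ ⟨q, rfl⟩
  have hF : ∀ q, A.val F (-j q) = ℓ' (AddMonoidAlgebra.single q 1) := by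
    intro q
    rw [val_restrict_of_mem _ (hmem q), neg_neg, Function.leftInverse_invFun hj q]
  have hrF : ∀ (r : AddMonoidAlgebra ℂ Q) q,
      A.val (r • F) (-j q) = ℓ' (AddMonoidAlgebra.single q 1 * r) := by
    intro r q
    induction r using AddMonoidAlgebra.induction_linear with
    | zero => simp
    | add f g hf hg => rw [add_smul, map_add, Pi.add_apply, hf, hg, mul_add, map_add]
    | single p c =>
      rw [val_single_smul _ _ _ (hmem q), ← neg_add', ← map_add, hF,
        AddMonoidAlgebra.single_mul_single, one_mul]
      rw [← smul_eq_mul, ← map_smul, AddMonoidAlgebra.smul_single, smul_eq_mul, mul_one]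
  refine ⟨LinearMap.toSpanSingleton _ _ F, fun x hx => ext_fn fun u hu => ?_⟩
  rw [hA] at hu
  obtain ⟨q, rfl⟩ := hu
  rw [LinearMap.toSpanSingleton_apply, hrF]
  have h1 : AddMonoidAlgebra.single q (1 : ℂ) * x ∈ I := I.mul_mem_left _ hx
  have h2 : ℓ' (AddMonoidAlgebra.single q 1 * x) = ℓ ⟨_, h1⟩ := by
    rw [← hℓ']; rfl
  have h3 : ℓ ⟨_, h1⟩ = A.val (g ⟨_, h1⟩) 0 := rfl
  have h4 : (⟨_, h1⟩ : I) = AddMonoidAlgebra.single q (1 : ℂ) • ⟨x, hx⟩ := rfl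
  rw [h2, h3, h4, map_smul, val_single_smul _ _ _ h0, one_mul, zero_sub]

theorem extVanish_of_eq_neg_range (hj : Function.Injective j)
    (hA : A.carrier = Set.range fun q => -j q) (p : Family j)
    (hp : ∀ S, S ⊆ A.carrier → p.mem S) {N : Type} [AddCommGroup N]
    [Module (AddMonoidAlgebra ℂ Q) N] (i : ℕ) :
    ExtVanish (AddMonoidAlgebra ℂ Q) N (A.fnSub p) (i + 1) := by
  have htop : A.fnSub p = ⊤ := by
    refine eq_top_iff.2 fun h _ => hp _ fun u hu => ?_
    by_contra hcon
    exact hu (val_of_notMem h hcon)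
  have h1 := (baer_fn hj hA).injective
  refine ExtVanish.congr_right ((Submodule.topEquiv).symm.trans
    (LinearEquiv.ofEq _ _ htop.symm)) (ExtVanish.of_injective ?_ i)
  exact Module.injective_object_of_injective_module _ _

theorem extVanish_of_periodic {N : Type} [AddCommGroup N]
    [Module (AddMonoidAlgebra ℂ Q) N] (hN : ∀ q : Q, ∃ χ : ℂ, ∀ x : N,
      (AddMonoidAlgebra.single q (1 : ℂ) - algebraMap ℂ (AddMonoidAlgebra ℂ Q) χ) • x = 0)
    (p : Family j) (q : Q) (hA : ∀ u ∈ A.carrier, u + j q ∈ A.carrier)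
    (hfin : ∀ S, p.mem S → ∀ u, ∃ K : ℕ, ∀ k ≥ K, u + k • j q ∉ S)
    (hstab : ∀ S, p.mem S → p.mem {u | ∃ k : ℕ, u + k • j q ∈ S}) (i : ℕ) :
    ExtVanish (AddMonoidAlgebra ℂ Q) N (A.fnSub p) i := by
  obtain ⟨χ, hχ⟩ := hN q
  exact ExtVanish.of_bijective _ hχ (bijective_smul p q χ hA hfin hstab) i

end DownSet

namespace Cochain

variable {ι : Type} [LinearOrder ι]

/-- The incidence sign of `i` in `T`. -/
def sgn (i : ι) (T : Finset ι) : ℂ := (-1) ^ (T.filter (· < i)).card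

/-- The simplicial coboundary. -/
def cobd (h : Finset ι → ℂ) (T : Finset ι) : ℂ := ∑ i ∈ T, sgn i T * h (T.erase i)

theorem sgn_mul_self (i : ι) (T : Finset ι) : sgn i T * sgn i T = 1 := by
  rw [sgn, ← pow_add, ← two_mul, pow_mul]; simp

theorem sgn_insert_of_lt {i v : ι} {T : Finset ι} (hv : v ∉ T) (h : v < i) :
    sgn i (insert v T) = -sgn i T := by
  rw [sgn, Finset.filter_insert, if_pos h, Finset.card_insert_of_notMem (by simp [hv]), pow_succ,
    sgn]
  ring

theorem sgn_insert_of_le {i v : ι} {T : Finset ι} (h : i ≤ v) :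
    sgn i (insert v T) = sgn i T := by
  rw [sgn, Finset.filter_insert, if_neg h.not_gt, sgn]

theorem sgn_mul_sgn_erase {i v : ι} {T : Finset ι} (hv : v ∉ T) (hi : i ∈ T) :
    sgn i T * sgn v ((insert v T).erase i) = -(sgn v (insert v T) * sgn i (insert v T)) := by
  have hiv : i ≠ v := fun h => hv (h ▸ hi)
  have h1 : T = insert i (T.erase i) := (Finset.insert_erase hi).symm
  have h2 : sgn v ((insert v T).erase i) = sgn v (T.erase i) := by
    rw [Finset.erase_insert_of_ne hiv.symm, sgn_insert_of_le le_rfl]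
  have h3 : sgn v (insert v T) = sgn v T := sgn_insert_of_le le_rfl
  rw [h2, h3]
  rcases lt_or_gt_of_ne hiv with h | h
  · have h4 : sgn v T = -sgn v (T.erase i) := by
      conv_lhs => rw [h1]
      exact sgn_insert_of_lt (Finset.notMem_erase i T) h
    rw [h4, sgn_insert_of_le h.le]; ring
  · have h4 : sgn v T = sgn v (T.erase i) := by
      conv_lhs => rw [h1]
      exact sgn_insert_of_le h.le
    rw [h4, sgn_insert_of_lt hv h]; ring

theorem cobd_insert (h : Finset ι → ℂ) {v : ι} {T : Finset ι} (hv : v ∉ T) :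
    cobd h (insert v T) = sgn v (insert v T) * h T +
      ∑ i ∈ T, sgn i (insert v T) * h ((insert v T).erase i) := by
  rw [cobd, Finset.sum_insert hv, Finset.erase_insert hv]

theorem sum_sgn_link (h : Finset ι → ℂ) {v : ι} {T : Finset ι} (hv : v ∉ T) :
    ∑ i ∈ T, sgn i T * (sgn v (insert v (T.erase i)) * h (insert v (T.erase i))) =
      h T - sgn v (insert v T) * cobd h (insert v T) := by
  rw [cobd_insert h hv, mul_add, ← mul_assoc, sgn_mul_self, one_mul, sub_add_cancel_left,
    Finset.mul_sum, ← Finset.sum_neg_distrib]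
  refine Finset.sum_congr rfl fun i hi => ?_
  have hiv : v ≠ i := fun h => hv (h ▸ hi)
  rw [← Finset.erase_insert_of_ne hiv, ← mul_assoc, sgn_mul_sgn_erase hv hi]
  ring

theorem cobd_sub (f g : Finset ι → ℂ) (T : Finset ι) :
    cobd (fun S => f S - g S) T = cobd f T - cobd g T := by
  simp only [cobd, mul_sub, Finset.sum_sub_distrib]

theorem cobd_add (f g : Finset ι → ℂ) (T : Finset ι) :
    cobd (fun S => f S + g S) T = cobd f T + cobd g T := by
  simp only [cobd, mul_add, Finset.sum_add_distrib]

theorem cobd_cobd (h : Finset ι → ℂ) (T : Finset ι) : cobd (cobd h) T = 0 := by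
  induction T using Finset.induction_on generalizing h with
  | empty => simp [cobd]
  | insert v T hv ih =>
    have key := sum_sgn_link (cobd h) hv
    have h1 : ∑ i ∈ T, sgn i T * (sgn v (insert v (T.erase i)) * cobd h (insert v (T.erase i))) =
        ∑ i ∈ T, sgn i T * h (T.erase i) -
          cobd (cobd fun S => sgn v (insert v S) * h (insert v S)) T := by
      rw [cobd, ← Finset.sum_sub_distrib]
      refine Finset.sum_congr rfl fun i hi => ?_
      have h2 := sum_sgn_link h (v := v) (T := T.erase i) (by simp [hv])
      have h3 : cobd (fun S => sgn v (insert v S) * h (insert v S)) (T.erase i) =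
        h (T.erase i) - sgn v (insert v (T.erase i)) * cobd h (insert v (T.erase i)) := h2
      rw [h3]
      ring
    rw [h1, ih] at key
    have h2 : sgn v (insert v T) * cobd (cobd h) (insert v T) = 0 := by
      rw [sub_zero] at key
      have : cobd h T = ∑ i ∈ T, sgn i T * h (T.erase i) := rfl
      linear_combination key + this
    have := congrArg (sgn v (insert v T) * ·) h2
    simpa only [← mul_assoc, sgn_mul_self, one_mul, mul_zero] using this

/-- Vanishing of the reduced cohomology of a family of simplices. -/
def Acyclic (D : Set (Finset ι)) : Prop :=
  ∀ h : Finset ι → ℂ, (∀ T ∈ D, cobd h T = 0) → ∃ g : Finset ι → ℂ, ∀ T ∈ D, cobd g T = h T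

theorem acyclic_of_cone {D : Set (Finset ι)} (v : ι) (hD : ∀ T ∈ D, insert v T ∈ D) :
    Acyclic D := by
  intro h hh
  refine ⟨fun T => if v ∈ T then 0 else sgn v (insert v T) * h (insert v T), fun T hT => ?_⟩
  by_cases hv : v ∈ T
  · rw [cobd, Finset.sum_eq_single_of_mem v hv]
    · rw [if_neg (Finset.notMem_erase v T), Finset.insert_erase hv, ← mul_assoc, sgn_mul_self,
        one_mul]
    · intro i _ hi
      rw [if_pos (Finset.mem_erase.2 ⟨hi.symm, hv⟩), mul_zero]
  · have h1 := sum_sgn_link h hv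
    rw [hh _ (hD T hT), mul_zero, sub_zero] at h1
    rw [← h1, cobd]
    refine Finset.sum_congr rfl fun i _ => ?_
    rw [if_neg fun h => hv (Finset.mem_of_mem_erase h)]

theorem acyclic_of_deletion_link {D : Set (Finset ι)} (v : ι)
    (hD : ∀ T, insert v T ∈ D → T ∈ D)
    (h₀ : Acyclic {T | v ∉ T ∧ T ∈ D}) (h₁ : Acyclic {T | v ∉ T ∧ insert v T ∈ D}) :
    Acyclic D := by
  intro h hh
  obtain ⟨g₀, hg₀⟩ := h₀ h fun T hT => hh T hT.2
  let h' : Finset ι → ℂ := fun T => h T - cobd g₀ T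
  have hh' : ∀ T ∈ D, cobd h' T = 0 := fun T hT => by
    rw [cobd_sub, hh T hT, cobd_cobd, sub_zero]
  have hz : ∀ T, v ∉ T → T ∈ D → h' T = 0 := fun T hv hT => by
    simp only [h', hg₀ T ⟨hv, hT⟩, sub_self]
  obtain ⟨m, hm⟩ := h₁ (fun T => sgn v (insert v T) * h' (insert v T)) fun T hT => by
    rw [cobd, sum_sgn_link h' hT.1, hz T hT.1 (hD T hT.2), hh' _ hT.2, mul_zero, sub_zero]
  refine ⟨fun T => g₀ T + if v ∈ T then -(sgn v T * m (T.erase v)) else 0, fun T hT => ?_⟩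
  rw [cobd_add]
  by_cases hv : v ∈ T
  · obtain ⟨S, hS, rfl⟩ : ∃ S, v ∉ S ∧ T = insert v S :=
      ⟨T.erase v, Finset.notMem_erase v T, (Finset.insert_erase hv).symm⟩
    have h1 := hm S ⟨hS, hT⟩
    have h2 : cobd (fun T => if v ∈ T then -(sgn v T * m (T.erase v)) else 0) (insert v S) =
        sgn v (insert v S) * cobd m S := by
      rw [cobd_insert _ hS, if_neg hS, mul_zero, zero_add, cobd, Finset.mul_sum]
      refine Finset.sum_congr rfl fun i hi => ?_
      have hiv : v ≠ i := fun h => hS (h ▸ hi)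
      have h3 := sgn_mul_sgn_erase hS hi
      have h4 := sgn_mul_self i S
      have h5 := sgn_mul_self i (insert v S)
      rw [if_pos (Finset.mem_erase.2 ⟨hiv, hv⟩), Finset.erase_right_comm, Finset.erase_insert hS]
      have h6 : sgn i (insert v S) * sgn v ((insert v S).erase i) =
          -(sgn v (insert v S) * sgn i S) := by
        linear_combination sgn i S * sgn i (insert v S) * h3 -
          sgn i (insert v S) * sgn v ((insert v S).erase i) * h4 - sgn v (insert v S) * sgn i S * h5
      linear_combination -(m (S.erase i)) * h6
    rw [h2, h1, ← mul_assoc, sgn_mul_self, one_mul]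
    simp only [h']
    ring
  · rw [hg₀ T ⟨hv, hT⟩]
    have : cobd (fun T => if v ∈ T then -(sgn v T * m (T.erase v)) else 0) T = 0 :=
      Finset.sum_eq_zero fun i _ => by
        dsimp only
        rw [if_neg fun h => hv (Finset.mem_of_mem_erase h), mul_zero]
    rw [this, add_zero]

variable {G : Type} [AddCommGroup G] (σ : ι → G →+ ℤ)

/-- The coordinate sets `T` vanishing on some nontrivial point of the cone. -/
def IsFace (T : Finset ι) : Prop :=
  ∃ y, (∀ i, 0 ≤ σ i y) ∧ (∃ i, 0 < σ i y) ∧ ∀ i ∈ T, σ i y = 0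

variable {σ}

omit [LinearOrder ι] in
theorem IsFace.mono {S T : Finset ι} (h : S ⊆ T) : IsFace σ T → IsFace σ S :=
  fun ⟨y, h1, h2, h3⟩ => ⟨y, h1, h2, fun i hi => h3 i (h hi)⟩

theorem acyclic_faces (N Z : Finset ι) (u : G) (hZ : ∀ i ∈ Z, σ i u = 0)
    (hneg : ∀ i, σ i u < 0 → i ∈ N) (hN : ∀ i ∈ N, σ i u ≤ 0) (hne : N.Nonempty)
    (hpos : ∃ i, 0 < σ i u) : Acyclic {T | T ⊆ N ∧ IsFace σ (T ∪ Z)} := by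
  induction N using Finset.strongInduction generalizing Z u with
  | H N ih =>
  have cone : ∀ v ∈ N, IsFace σ (N ∪ Z) → Acyclic {T | T ⊆ N ∧ IsFace σ (T ∪ Z)} := by
    intro v hv hf
    refine acyclic_of_cone v fun T hT => ?_
    have hT' : insert v T ⊆ N := Finset.insert_subset hv hT.1
    exact ⟨hT', hf.mono (Finset.union_subset_union_left hT')⟩
  have caseA : ∀ u : G, (∀ i ∈ Z, σ i u = 0) → (∀ i, σ i u < 0 → i ∈ N) →
      (∀ i ∈ N, σ i u ≤ 0) → (∃ i, 0 < σ i u) → ∀ v ∈ N, σ v u = 0 →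
      Acyclic {T | T ⊆ N ∧ IsFace σ (T ∪ Z)} := by
    intro u hZ hneg hN hpos v hv hvu
    by_cases hNv : N = {v}
    · refine cone v hv ⟨u, fun i => ?_, hpos, fun i hi => ?_⟩
      · by_contra! hi
        obtain rfl := Finset.mem_singleton.1 (hNv ▸ hneg i hi)
        exact hi.ne hvu
      · rcases Finset.mem_union.1 hi with h | h
        · obtain rfl := Finset.mem_singleton.1 (hNv ▸ h)
          exact hvu
        · exact hZ i h
    · have hlt : N.erase v ⊂ N := Finset.erase_ssubset hv
      have hneg' : ∀ i, σ i u < 0 → i ∈ N.erase v := fun i hi =>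
        Finset.mem_erase.2 ⟨fun h => hi.ne (h ▸ hvu), hneg i hi⟩
      have hne' : (N.erase v).Nonempty := by
        rw [Finset.nonempty_iff_ne_empty]
        intro h
        rcases Finset.erase_eq_empty_iff N v |>.1 h with h | h
        · simp [h] at hv
        · exact hNv h
      have hN' : ∀ i ∈ N.erase v, σ i u ≤ 0 := fun i hi => hN i (Finset.mem_of_mem_erase hi)
      refine acyclic_of_deletion_link v (fun T hT => ⟨(Finset.subset_insert v T).trans hT.1,
        hT.2.mono (Finset.union_subset_union_left (Finset.subset_insert v T))⟩) ?_ ?_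
      · convert ih _ hlt Z u hZ hneg' hN' hne' hpos using 1
        ext T
        simp only [Set.mem_ofPred_eq, Finset.subset_erase]
        tauto
      · convert ih _ hlt (insert v Z) u ?_ hneg' hN' hne' hpos using 1
        · ext T
          simp only [Set.mem_ofPred_eq, Finset.subset_erase, Finset.insert_subset_iff,
            Finset.union_insert, Finset.insert_union]
          tauto
        · intro i hi
          rcases Finset.mem_insert.1 hi with rfl | h
          · exact hvu
          · exact hZ i h
  by_cases hv : ∃ v ∈ N, σ v u = 0
  · obtain ⟨v, hv, hvu⟩ := hv
    exact caseA u hZ hneg hN hpos v hv hvu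
  push Not at hv
  by_cases hf : IsFace σ Z
  · obtain ⟨y, hy, hy', hyZ⟩ := hf
    by_cases hyN : ∀ i ∈ N, σ i y = 0
    · obtain ⟨v, hv⟩ := hne
      refine cone v hv ⟨y, hy, hy', fun i hi => ?_⟩
      rcases Finset.mem_union.1 hi with h | h
      exacts [hyN i h, hyZ i h]
    · push Not at hyN
      obtain ⟨i₀, hi₀, hi₀y⟩ := hyN
      obtain ⟨v, hvm, hmin⟩ := (N.filter fun i => 0 < σ i y).exists_min_image
        (fun i => (-σ i u : ℚ) / σ i y)
        ⟨i₀, Finset.mem_filter.2 ⟨hi₀, lt_of_le_of_ne (hy i₀) hi₀y.symm⟩⟩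
      obtain ⟨hvN, hvy⟩ := Finset.mem_filter.1 hvm
      have hvu : σ v u < 0 := lt_of_le_of_ne (hN v hvN) (hv v hvN)
      have heval : ∀ i, σ i (σ v y • u - σ v u • y) = σ v y * σ i u - σ v u * σ i y := by
        intro i; simp
      refine caseA (σ v y • u - σ v u • y) ?_ ?_ ?_ ?_ v hvN ?_
      · intro i hi
        rw [heval, hZ i hi, hyZ i hi]; ring
      · intro i hi
        by_contra hiN
        have h1 : 0 ≤ σ i u := by
          by_contra! h; exact hiN (hneg i h)
        rw [heval] at hi
        nlinarith [hy i, mul_nonneg hvy.le h1, mul_nonneg (neg_nonneg.2 hvu.le) (hy i)]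
      · intro i hi
        rw [heval]
        rcases (hy i).eq_or_lt with h | h
        · rw [← h]
          nlinarith [hN i hi]
        · have h1 := hmin i (Finset.mem_filter.2 ⟨hi, h⟩)
          rw [div_le_div_iff₀ (by exact_mod_cast hvy) (by exact_mod_cast h)] at h1
          have h2 : -σ v u * σ i y ≤ -σ i u * σ v y := by exact_mod_cast h1
          linarith
      · obtain ⟨i, hi⟩ := hpos
        refine ⟨i, ?_⟩
        rw [heval]
        nlinarith [mul_pos hvy hi, mul_nonneg (neg_nonneg.2 hvu.le) (hy i)]
      · rw [heval]; ring
  · intro h _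
    exact ⟨0, fun T hT => (hf (hT.2.mono Finset.subset_union_right)).elim⟩

end Cochain

namespace DownSet

variable {Q G : Type} [AddCommMonoid Q] [AddCommGroup G] {j : Q →+ G}

/-- The subsets of `C` on which the functionals in `s` are bounded above. -/
def Family.bounded (C : Set G) (hC : ∀ u ∈ C, ∀ q, u + j q ∈ C) (s : Set (G →+ ℤ)) :
    Family j where
  mem S := S ⊆ C ∧ ∀ ℓ ∈ s, ∃ B, ∀ u ∈ S, ℓ u ≤ B
  empty := ⟨Set.empty_subset C, fun _ _ => ⟨0, fun _ h => h.elim⟩⟩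
  mono S T hST hT := ⟨hST.trans hT.1, fun ℓ hℓ =>
    (hT.2 ℓ hℓ).imp fun _ hB u hu => hB u (hST hu)⟩
  union S T hS hT := ⟨Set.union_subset hS.1 hT.1, fun ℓ hℓ => by
    obtain ⟨B, hB⟩ := hS.2 ℓ hℓ
    obtain ⟨B', hB'⟩ := hT.2 ℓ hℓ
    refine ⟨max B B', fun u hu => ?_⟩
    rcases hu with hu | hu
    exacts [(hB u hu).trans (le_max_left _ _), (hB' u hu).trans (le_max_right _ _)]⟩
  shift S hS q := ⟨fun u hu => by simpa using hC _ (hS.1 hu) q, fun ℓ hℓ => by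
    obtain ⟨B, hB⟩ := hS.2 ℓ hℓ
    refine ⟨B + ℓ (j q), fun u hu => ?_⟩
    have := hB _ hu
    rw [map_sub] at this
    linarith⟩

theorem extVanish_bounded {A : DownSet j} {N : Type} [AddCommGroup N]
    [Module (AddMonoidAlgebra ℂ Q) N] (hN : ∀ q : Q, ∃ χ : ℂ, ∀ x : N,
      (AddMonoidAlgebra.single q (1 : ℂ) - algebraMap ℂ (AddMonoidAlgebra ℂ Q) χ) • x = 0)
    {C : Set G} (hC : ∀ u ∈ C, ∀ q, u + j q ∈ C) {s : Set (G →+ ℤ)} (q : Q)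
    (hA : ∀ u ∈ A.carrier, u + j q ∈ A.carrier) (hCq : ∀ u, u + j q ∈ C → u ∈ C)
    (hs : ∀ ℓ ∈ s, 0 ≤ ℓ (j q)) (hpos : ∃ ℓ ∈ s, 0 < ℓ (j q)) (i : ℕ) :
    ExtVanish (AddMonoidAlgebra ℂ Q) N (A.fnSub (Family.bounded C hC s)) i := by
  refine extVanish_of_periodic hN _ q hA ?_ ?_ i
  · rintro S ⟨-, hS⟩ u
    obtain ⟨ℓ, hℓ, hℓq⟩ := hpos
    obtain ⟨B, hB⟩ := hS ℓ hℓ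
    refine ⟨(B - ℓ u).toNat + 1, fun k hk hmem => ?_⟩
    have h1 := hB _ hmem
    rw [map_add, map_nsmul, nsmul_eq_mul] at h1
    have h2 : B - ℓ u + 1 ≤ k := by omega
    nlinarith
  · rintro S ⟨hSC, hS⟩
    refine ⟨?_, fun ℓ hℓ => ?_⟩
    · rintro u ⟨k, hk⟩
      have : ∀ k : ℕ, u + k • j q ∈ C → u ∈ C := by
        intro k
        induction k with
        | zero => simp
        | succ k ih =>
          intro h
          rw [succ_nsmul, ← add_assoc] at h
          exact ih (hCq _ h)
      exact this k (hSC hk)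
    · obtain ⟨B, hB⟩ := hS ℓ hℓ
      refine ⟨B, ?_⟩
      rintro u ⟨k, hk⟩
      have h1 := hB _ hk
      rw [map_add, map_nsmul, nsmul_eq_mul] at h1
      nlinarith [mul_nonneg (Int.natCast_nonneg k) (hs ℓ hℓ)]

open Cochain

variable {ι : Type} [LinearOrder ι] {σ : ι → G →+ ℤ}

/-- The points which are nonpositive along `T`, and everywhere if `T` is not a face. -/
def region (hσ : ∀ q i, 0 ≤ σ i (j q)) (T : Finset ι) : DownSet j where
  carrier := {u | (∀ i ∈ T, σ i u ≤ 0) ∧ (¬ IsFace σ T → ∀ i, σ i u ≤ 0)}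
  sub_mem u hu q := by
    refine ⟨fun i hi => ?_, fun h i => ?_⟩
    · rw [map_sub]; linarith [hu.1 i hi, hσ q i]
    · rw [map_sub]; linarith [hu.2 h i, hσ q i]

variable {hσ : ∀ q i, 0 ≤ σ i (j q)}

theorem region_anti {S T : Finset ι} (h : S ⊆ T) {u : G} (hu : u ∈ (region hσ T).carrier) :
    u ∈ (region hσ S).carrier :=
  ⟨fun i hi => hu.1 i (h hi), fun hf => hu.2 fun hT => hf (hT.mono h)⟩

theorem acyclic_region [Fintype ι] {u : G} (hu : ∃ i, σ i u ≤ 0) :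
    Acyclic {T | u ∈ (region hσ T).carrier} := by
  obtain ⟨v, hv⟩ := hu
  by_cases hall : ∀ i, σ i u ≤ 0
  · exact acyclic_of_cone v fun T _ => ⟨fun i _ => hall i, fun _ => hall⟩
  · have hpos : ∃ i, 0 < σ i u := by simpa using hall
    convert acyclic_faces (σ := σ) (Finset.univ.filter fun i => σ i u ≤ 0) ∅ u (by simp)
      (fun i hi => by simpa using hi.le) (by simp) ⟨v, by simpa using hv⟩ hpos using 1
    ext T
    simp only [Set.mem_ofPred_eq, Finset.union_empty, Finset.subset_iff, Finset.mem_filter,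
      Finset.mem_univ, true_and, region]
    tauto

variable [Fintype ι]

variable (hσ) in
/-- The functions on `region T` with support bounded above. -/
abbrev Term (T : Finset ι) : Type :=
  (region hσ T).fnSub (Family.bounded Set.univ (fun _ _ _ => Set.mem_univ _) {∑ i, σ i})

variable (hσ) in
/-- The terms of the complex resolving the functions supported in the interior. -/
abbrev Terms (n : ℕ) : Type := ∀ T : {T : Finset ι // T.card = n}, Term hσ T.1

/-- The cochain of values at a point. -/
noncomputable def cochain {n : ℕ} (h : Terms hσ n) (u : G) (S : Finset ι) : ℂ :=
  if hS : S.card = n then (region hσ S).val (h ⟨S, hS⟩).1 u else 0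

theorem cochain_eq {n : ℕ} (h : Terms hσ n) (u : G) (S : {S : Finset ι // S.card = n}) :
    cochain h u S.1 = (region hσ S.1).val (h S).1 u := dif_pos S.2

theorem cochain_add {n : ℕ} (h g : Terms hσ n) (u : G) (S : Finset ι) :
    cochain (h + g) u S = cochain h u S + cochain g u S := by
  by_cases hS : S.card = n
  · simp [cochain, hS]
  · simp [cochain, hS]

theorem cochain_zero {n : ℕ} (u : G) : cochain (0 : Terms hσ n) u = 0 := by
  funext S
  simp [cochain]

theorem cochain_single_smul {n : ℕ} (q : Q) (c : ℂ) (h : Terms hσ n) {u : G} {S : Finset ι}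
    (hu : u ∈ (region hσ S).carrier) :
    cochain (AddMonoidAlgebra.single q c • h) u S = c * cochain h (u - j q) S := by
  by_cases hS : S.card = n
  · simp [cochain, hS, val_single_smul q c _ hu]
  · simp [cochain, hS]

theorem exists_bound {n : ℕ} (h : Terms hσ n) :
    ∃ B : ℤ, ∀ u, B < ∑ i, σ i u → cochain h u = 0 := by
  have : ∀ T, ∃ B : ℤ, ∀ u ∈ Function.support ((region hσ T.1).val (h T).1), ∑ i, σ i u ≤ B := by
    intro T
    simpa using (h T).2.2 _ rfl
  choose B hB using this
  obtain ⟨M, hM⟩ := (Set.finite_range B).bddAbove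
  refine ⟨M, fun u hu => funext fun S => ?_⟩
  by_cases hS : S.card = n
  · rw [cochain_eq h u ⟨S, hS⟩]
    by_contra hne
    exact absurd ((hB ⟨S, hS⟩ u hne).trans (hM ⟨_, rfl⟩)) hu.not_ge
  · simp [cochain, hS]

/-- Assemble functions into a term of the complex. -/
noncomputable def ofFun (n : ℕ) (f : G → Finset ι → ℂ)
    (hf : ∃ B : ℤ, ∀ u, B < ∑ i, σ i u → f u = 0) : Terms hσ n :=
  fun T => ⟨(region hσ T.1).restrict fun u => f u T.1, Set.subset_univ _, by
    rintro _ rfl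
    obtain ⟨B, hB⟩ := hf
    refine ⟨B, fun u hu => ?_⟩
    by_cases huT : u ∈ (region hσ T.1).carrier
    · rw [Function.mem_support, val_restrict_of_mem _ huT] at hu
      by_contra! hlt
      exact hu (by rw [hB u (by simpa using hlt)]; rfl)
    · exact absurd (val_of_notMem _ huT) hu⟩

theorem cochain_ofFun {n : ℕ} {f : G → Finset ι → ℂ}
    (hf : ∃ B : ℤ, ∀ u, B < ∑ i, σ i u → f u = 0) {u : G} {S : Finset ι} (hS : S.card = n)
    (hu : u ∈ (region hσ S).carrier) : cochain (ofFun (hσ := hσ) n f hf) u S = f u S := by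
  rw [cochain_eq _ u ⟨S, hS⟩]
  exact val_restrict_of_mem _ hu

theorem terms_ext {n : ℕ} {h g : Terms hσ n} (H : ∀ (S : Finset ι) (u : G), S.card = n →
    u ∈ (region hσ S).carrier → cochain h u S = cochain g u S) : h = g := by
  refine funext fun T => Subtype.ext (ext_fn fun u hu => ?_)
  rw [← cochain_eq, ← cochain_eq]
  exact H _ _ T.2 hu

theorem cobd_congr {f g : Finset ι → ℂ} {T : Finset ι} (h : ∀ i ∈ T, f (T.erase i) = g (T.erase i)) :
    cobd f T = cobd g T :=
  Finset.sum_congr rfl fun i hi => by rw [h i hi]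

theorem cobd_zero (T : Finset ι) : cobd 0 T = 0 := by simp [cobd]

theorem cobd_bound {n : ℕ} (h : Terms hσ n) :
    ∃ B : ℤ, ∀ u, B < ∑ i, σ i u → cobd (cochain h u) = 0 := by
  obtain ⟨B, hB⟩ := exists_bound h
  exact ⟨B, fun u hu => by rw [hB u hu]; exact funext cobd_zero⟩

theorem cochain_d {n : ℕ} (h : Terms hσ n) {u : G} {T : Finset ι} (hT : T.card = n + 1)
    (hu : u ∈ (region hσ T).carrier) :
    cochain (ofFun (hσ := hσ) (n + 1) (fun u => cobd (cochain h u)) (cobd_bound h)) u T =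
      cobd (cochain h u) T := cochain_ofFun _ hT hu

theorem map_smul_of_single {X Y : Type} [AddCommGroup X] [AddCommGroup Y]
    [Module (AddMonoidAlgebra ℂ Q) X] [Module (AddMonoidAlgebra ℂ Q) Y] (f : X →+ Y)
    (hf : ∀ (q : Q) (c : ℂ) x, f (AddMonoidAlgebra.single q c • x) = AddMonoidAlgebra.single q c • f x)
    (r : AddMonoidAlgebra ℂ Q) (x : X) : f (r • x) = r • f x := by
  induction r using AddMonoidAlgebra.induction_linear with
  | zero => simp
  | add a b ha hb => rw [add_smul, map_add, ha, hb, add_smul]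
  | single q c => exact hf q c x

variable (hσ) in
/-- The differential of the complex. -/
noncomputable def diff (n : ℕ) : Terms hσ n →ₗ[AddMonoidAlgebra ℂ Q] Terms hσ (n + 1) :=
  let f : Terms hσ n →+ Terms hσ (n + 1) := AddMonoidHom.mk'
    (fun h => ofFun (n + 1) (fun u => cobd (cochain h u)) (cobd_bound h)) fun g h => by
      refine terms_ext fun S u hS hu => ?_
      rw [cochain_add, cochain_d _ hS hu, cochain_d _ hS hu, cochain_d _ hS hu,
        funext (cochain_add g h u), cobd_add]
  { f with
    map_smul' := map_smul_of_single f fun q c h => terms_ext fun S u hS hu => by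
      change cochain (ofFun (n + 1) _ (cobd_bound (AddMonoidAlgebra.single q c • h))) u S =
        cochain (AddMonoidAlgebra.single q c • ofFun (n + 1) _ (cobd_bound h)) u S
      rw [cochain_single_smul _ _ _ hu, cochain_d _ hS hu,
        cochain_d _ hS ((region hσ S).sub_mem u hu q), cobd, cobd, Finset.mul_sum]
      refine Finset.sum_congr rfl fun i _ => ?_
      rw [cochain_single_smul _ _ _ (region_anti (Finset.erase_subset i S) hu)]
      ring }

theorem cochain_diff {n : ℕ} (h : Terms hσ n) {u : G} {T : Finset ι} (hT : T.card = n + 1)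
    (hu : u ∈ (region hσ T).carrier) : cochain (diff hσ n h) u T = cobd (cochain h u) T :=
  cochain_d h hT hu

theorem cobd_eq_zero_of_diff {n : ℕ} {h : Terms hσ n} (hh : diff hσ n h = 0) {u : G}
    {T : Finset ι} (hu : u ∈ (region hσ T).carrier) : cobd (cochain h u) T = 0 := by
  by_cases hT : T.card = n + 1
  · rw [← cochain_diff h hT hu, hh, cochain_zero]; rfl
  · refine Finset.sum_eq_zero fun i hi => ?_
    have := Finset.card_erase_add_one hi
    rw [cochain, dif_neg (by omega), mul_zero]

theorem exact_diff (n : ℕ) : Function.Exact (diff hσ n) (diff hσ (n + 1)) := by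
  intro h
  constructor
  · intro hh
    obtain ⟨B, hB⟩ := exists_bound h
    have : ∀ u, ∃ g : Finset ι → ℂ, (∀ T, T.card = n + 1 → u ∈ (region hσ T).carrier →
        cobd g T = cochain h u T) ∧ (B < ∑ i, σ i u → g = 0) := by
      intro u
      by_cases hu : B < ∑ i, σ i u
      · exact ⟨0, fun T _ _ => by rw [hB u hu, cobd_zero]; rfl, fun _ => rfl⟩
      by_cases hinner : ∃ i, σ i u ≤ 0
      · obtain ⟨g, hg⟩ := acyclic_region (hσ := hσ) hinner (cochain h u)
          fun T hT => cobd_eq_zero_of_diff hh hT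
        exact ⟨g, fun T _ hT => hg T hT, fun h => (hu h).elim⟩
      · push Not at hinner
        refine ⟨0, fun T hT hTu => ?_, fun h => (hu h).elim⟩
        obtain ⟨i, hi⟩ : T.Nonempty := Finset.card_pos.1 (by omega)
        exact absurd (hTu.1 i hi) (hinner i).not_ge
    choose g hg hgB using this
    refine ⟨ofFun n g ⟨B, hgB⟩, terms_ext fun S u hS hu => ?_⟩
    rw [cochain_diff _ hS hu, ← hg u S hS hu]
    refine cobd_congr fun i hi => ?_
    have := Finset.card_erase_add_one hi
    exact cochain_ofFun _ (by omega) (region_anti (Finset.erase_subset i S) hu)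
  · rintro ⟨g, rfl⟩
    refine terms_ext fun S u hS hu => ?_
    rw [cochain_diff _ hS hu, cochain_zero, Pi.zero_apply, ← cobd_cobd (cochain g u) S]
    refine cobd_congr fun i hi => ?_
    have := Finset.card_erase_add_one hi
    exact cochain_diff _ (by omega) (region_anti (Finset.erase_subset i S) hu)

theorem extVanish_term (hj : Function.Injective j)
    (hrange : ∀ u, u ∈ Set.range j ↔ ∀ i, 0 ≤ σ i u) {N : Type} [AddCommGroup N]
    [Module (AddMonoidAlgebra ℂ Q) N] (hN : ∀ q : Q, ∃ χ : ℂ, ∀ x : N,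
      (AddMonoidAlgebra.single q (1 : ℂ) - algebraMap ℂ (AddMonoidAlgebra ℂ Q) χ) • x = 0)
    (T : Finset ι) (i : ℕ) : ExtVanish (AddMonoidAlgebra ℂ Q) N (Term hσ T) (i + 1) := by
  by_cases hT : IsFace σ T
  · have hT' := hT
    obtain ⟨y, hy, ⟨k, hk⟩, hyT⟩ := hT
    obtain ⟨q, rfl⟩ := (hrange y).2 hy
    have hpos : 0 < ∑ i, σ i (j q) :=
      Finset.sum_pos' (fun i _ => hy i) ⟨k, Finset.mem_univ k, hk⟩
    refine extVanish_bounded (A := region hσ T) (C := Set.univ) (s := {∑ i, σ i}) hN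
      (fun _ _ _ => Set.mem_univ _) q ?_ (fun _ _ => Set.mem_univ _) ?_
      ⟨_, rfl, by simpa using hpos⟩ _
    · intro u hu
      refine ⟨fun i hi => ?_, fun h => (h hT').elim⟩
      rw [map_add, hyT i hi, add_zero]
      exact hu.1 i hi
    · rintro _ rfl
      simpa using hpos.le
  · have hcar : (region hσ T).carrier = {u | ∀ i, σ i u ≤ 0} := by
      ext u
      exact ⟨fun hu => hu.2 hT, fun hu => ⟨fun i _ => hu i, fun _ => hu⟩⟩
    refine extVanish_of_eq_neg_range hj ?_ _ ?_ i
    · rw [hcar]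
      ext u
      constructor
      · intro hu
        obtain ⟨q, hq⟩ := (hrange (-u)).2 fun i => by simpa using hu i
        exact ⟨q, by simp [hq]⟩
      · rintro ⟨q, rfl⟩ i
        simpa using hσ q i
    · intro S hS
      refine ⟨Set.subset_univ _, ?_⟩
      rintro _ rfl
      refine ⟨0, fun u hu => ?_⟩
      have := hS hu
      rw [hcar] at this
      simpa using Finset.sum_nonpos fun i _ => this i

variable (j) in
/-- The whole group as a down-set. -/
def whole : DownSet j := ⟨Set.univ, fun _ _ _ => Set.mem_univ _⟩

theorem pos_add (hσ : ∀ q i, 0 ≤ σ i (j q)) : ∀ u ∈ {u | ∀ i, 0 < σ i u}, ∀ q,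
    u + j q ∈ {u | ∀ i, 0 < σ i u} := by
  intro u hu q i
  rw [map_add]
  linarith [hu i, hσ q i]

variable (hσ) in
/-- Functions supported in the interior of the cone, with support bounded above. -/
abbrev Canon : Type :=
  (whole j).fnSub (Family.bounded {u | ∀ i, 0 < σ i u} (pos_add hσ) {∑ i, σ i})

theorem canon_bound (f : Canon hσ) : ∃ B : ℤ, ∀ u, B < ∑ i, σ i u →
    (fun _ : Finset ι => (whole j).val f.1 u) = 0 := by
  obtain ⟨B, hB⟩ := f.2.2 _ rfl
  refine ⟨B, fun u hu => funext fun S => ?_⟩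
  by_contra hne
  have := hB u hne
  simp at this
  omega

variable (hσ) in
/-- The augmentation of the complex. -/
noncomputable def augment : Canon hσ →ₗ[AddMonoidAlgebra ℂ Q] Terms hσ 0 :=
  let f : Canon hσ →+ Terms hσ 0 := AddMonoidHom.mk'
    (fun f => ofFun 0 (fun u _ => (whole j).val f.1 u) (canon_bound f)) fun g h => by
      refine terms_ext fun S u hS hu => ?_
      rw [cochain_add, cochain_ofFun _ hS hu, cochain_ofFun _ hS hu, cochain_ofFun _ hS hu]
      simp
  { f with
    map_smul' := map_smul_of_single f fun q c h => terms_ext fun S u hS hu => by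
      change cochain (ofFun 0 _ (canon_bound (AddMonoidAlgebra.single q c • h))) u S =
        cochain (AddMonoidAlgebra.single q c • ofFun 0 _ (canon_bound h)) u S
      rw [cochain_single_smul _ _ _ hu, cochain_ofFun _ hS hu,
        cochain_ofFun _ hS ((region hσ S).sub_mem u hu q)]
      exact val_single_smul q c h.1 trivial }

theorem cochain_augment (f : Canon hσ) {u : G} {T : Finset ι} (hT : T.card = 0)
    (hu : u ∈ (region hσ T).carrier) : cochain (augment hσ f) u T = (whole j).val f.1 u :=
  cochain_ofFun _ hT hu

theorem mem_region_empty {u : G} (hu : ∀ i, 0 < σ i u) : u ∈ (region hσ ∅).carrier := by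
  refine ⟨by simp, fun h => ?_⟩
  by_contra! hcon
  obtain ⟨i, hi⟩ := hcon
  exact h ⟨u, fun i => (hu i).le, ⟨i, hi⟩, by simp⟩

theorem augment_injective : Function.Injective (augment hσ) := by
  refine (injective_iff_map_eq_zero _).2 fun f hf => Subtype.ext (ext_fn fun u _ => ?_)
  by_cases hu : ∀ i, 0 < σ i u
  · rw [← cochain_augment f Finset.card_empty (mem_region_empty hu), hf, cochain_zero]
    simp
  · refine (Function.notMem_support.1 fun h => hu (f.2.1 h)).trans ?_
    simp

theorem range_augment : LinearMap.range (augment hσ) = LinearMap.ker (diff hσ 0) := by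
  ext h
  constructor
  · rintro ⟨f, rfl⟩
    refine terms_ext fun S u hS hu => ?_
    rw [cochain_diff _ hS hu, cochain_zero]
    refine Finset.sum_eq_zero fun i hi => ?_
    have := Finset.card_erase_add_one hi
    rw [cochain_augment f (by omega) (region_anti (Finset.erase_subset i S) hu),
      Function.notMem_support.1 fun h => (hu.1 i hi).not_gt (f.2.1 h i), mul_zero]
  · intro hh
    have hv : ∀ u, (whole j).val ((whole j).restrict fun u => cochain h u ∅) u = cochain h u ∅ :=
      fun u => val_restrict_of_mem _ trivial
    refine ⟨⟨(whole j).restrict fun u => cochain h u ∅, ?_, ?_⟩, ?_⟩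
    · intro u hu
      by_contra hinner
      rw [Function.mem_support, hv] at hu
      by_cases hu0 : u ∈ (region hσ ∅).carrier
      · obtain ⟨g, hg⟩ := acyclic_region (hσ := hσ) (by simpa using hinner) (cochain h u)
          fun T hT => cobd_eq_zero_of_diff hh hT
        exact hu ((hg ∅ hu0).symm.trans (by simp [cobd]))
      · refine hu ?_
        rw [cochain_eq h u ⟨∅, Finset.card_empty⟩, val_of_notMem _ hu0]
    · rintro _ rfl
      obtain ⟨B, hB⟩ := exists_bound h
      refine ⟨B, fun u hu => ?_⟩
      rw [Function.mem_support, hv] at hu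
      by_contra! hlt
      exact hu (by rw [hB u (by simpa using hlt)]; rfl)
    · refine terms_ext fun S u hS hu => ?_
      rw [cochain_augment _ hS hu, hv, Finset.card_eq_zero.1 hS]

theorem extVanish_canon (hj : Function.Injective j)
    (hrange : ∀ u, u ∈ Set.range j ↔ ∀ i, 0 ≤ σ i u) {N : Type} [AddCommGroup N]
    [Module (AddMonoidAlgebra ℂ Q) N] (hN : ∀ q : Q, ∃ χ : ℂ, ∀ x : N,
      (AddMonoidAlgebra.single q (1 : ℂ) - algebraMap ℂ (AddMonoidAlgebra ℂ Q) χ) • x = 0)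
    (i : ℕ) : ExtVanish (AddMonoidAlgebra ℂ Q) N (Canon hσ) (Fintype.card ι + 1 + i) := by
  refine ExtVanish.congr_right
    (X := LinearMap.ker (diff hσ 0)) (Y := Canon hσ)
    ((LinearEquiv.ofInjective (augment hσ) augment_injective).trans
    (LinearEquiv.ofEq _ _ range_augment)).symm ?_
  refine ExtVanish.ker_of_exact (diff hσ) exact_diff (fun n i => ?_) _ (fun x => ?_) i
  · exact ExtVanish.pi (fun T => extVanish_term hj hrange hN T.1 i)
  · funext T
    have := T.1.card_le_univ
    exact absurd T.2 (by omega)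

end DownSet

namespace DownSet

variable {Q G : Type} [AddCommMonoid Q] [AddCommGroup G] {j : Q →+ G}

theorem mem_whole (u : G) : u ∈ (whole j).carrier := Set.mem_univ u

section Bounded

variable {C : Set G} (hC : ∀ u ∈ C, ∀ q, u + j q ∈ C)

theorem fnSub_bounded_inf (s t : Set (G →+ ℤ)) :
    (whole j).fnSub (Family.bounded C hC s) ⊓ (whole j).fnSub (Family.bounded C hC t) =
      (whole j).fnSub (Family.bounded C hC (s ∪ t)) := by
  ext f
  constructor
  · rintro ⟨h1, h2⟩
    exact ⟨h1.1, fun ℓ hℓ => hℓ.elim (h1.2 ℓ) (h2.2 ℓ)⟩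
  · intro h
    exact ⟨⟨h.1, fun ℓ hℓ => h.2 ℓ (Or.inl hℓ)⟩, ⟨h.1, fun ℓ hℓ => h.2 ℓ (Or.inr hℓ)⟩⟩

theorem fnSub_bounded_sup (s : Set (G →+ ℤ)) (e : G →+ ℤ) :
    (whole j).fnSub (Family.bounded C hC (insert e s)) ⊔
      (whole j).fnSub (Family.bounded C hC (insert (-e) s)) =
      (whole j).fnSub (Family.bounded C hC s) := by
  refine le_antisymm (sup_le ?_ ?_) fun f hf => ?_
  · exact fun f hf => ⟨hf.1, fun ℓ hℓ => hf.2 ℓ (Set.mem_insert_of_mem _ hℓ)⟩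
  · exact fun f hf => ⟨hf.1, fun ℓ hℓ => hf.2 ℓ (Set.mem_insert_of_mem _ hℓ)⟩
  · have hv : ∀ (S : Set G) u, (whole j).val ((whole j).restrict
        (S.indicator ((whole j).val f))) u = S.indicator ((whole j).val f) u :=
      fun S u => val_restrict_of_mem _ (mem_whole u)
    have hsub : ∀ (S : Set G) u, u ∈ Function.support ((whole j).val ((whole j).restrict
        (S.indicator ((whole j).val f)))) → u ∈ S ∧ u ∈ Function.support ((whole j).val f) := by
      intro S u hu
      rw [Function.mem_support, hv] at hu
      exact ⟨Set.mem_of_indicator_ne_zero hu, fun h => hu (by simp [Set.indicator, h])⟩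
    refine Submodule.mem_sup.2 ⟨(whole j).restrict ({u | e u ≤ 0}.indicator ((whole j).val f)),
      ⟨fun u hu => hf.1 (hsub _ u hu).2, ?_⟩,
      (whole j).restrict ({u | e u ≤ 0}ᶜ.indicator ((whole j).val f)),
      ⟨fun u hu => hf.1 (hsub _ u hu).2, ?_⟩, ?_⟩
    · rintro ℓ (rfl | hℓ)
      · exact ⟨0, fun u hu => (hsub _ u hu).1⟩
      · obtain ⟨B, hB⟩ := hf.2 ℓ hℓ
        exact ⟨B, fun u hu => hB u (hsub _ u hu).2⟩
    · rintro ℓ (rfl | hℓ)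
      · refine ⟨0, fun u hu => ?_⟩
        have : ¬ e u ≤ 0 := (hsub _ u hu).1
        simp only [AddMonoidHom.neg_apply]
        omega
      · obtain ⟨B, hB⟩ := hf.2 ℓ hℓ
        exact ⟨B, fun u hu => hB u (hsub _ u hu).2⟩
    · refine ext_fn fun u _ => ?_
      rw [map_add, Pi.add_apply, hv, hv, ← Pi.add_apply, Set.indicator_self_add_compl]

variable {N : Type} [AddCommGroup N] [Module (AddMonoidAlgebra ℂ Q) N]

theorem extVanish_bounded_union (hN : ∀ q : Q, ∃ χ : ℂ, ∀ x : N,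
      (AddMonoidAlgebra.single q (1 : ℂ) - algebraMap ℂ (AddMonoidAlgebra ℂ Q) χ) • x = 0)
    (s : Set (G →+ ℤ)) (e : G →+ ℤ) {q q' : Q} (hq' : j q' = -j q) (he : 0 < e (j q))
    (hs : ∀ ℓ ∈ s, ℓ (j q) = 0) {n : ℕ}
    (h : ∀ i, ExtVanish (AddMonoidAlgebra ℂ Q) N
      ((whole j).fnSub (Family.bounded C hC s)) (n + i)) (i : ℕ) :
    ExtVanish (AddMonoidAlgebra ℂ Q) N
      ((whole j).fnSub (Family.bounded C hC (insert e s ∪ insert (-e) s))) (n + 1 + i) := by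
  rw [← fnSub_bounded_inf, add_right_comm]
  refine ExtVanish.inf _ _ ?_ ?_ ?_
  · refine extVanish_bounded hN hC q (fun _ _ => mem_whole _) ?_ ?_ ⟨e, Or.inl rfl, he⟩ _
    · intro u hu
      have := hC _ hu q'
      rwa [hq', add_neg_cancel_right] at this
    · rintro ℓ (rfl | hℓ)
      exacts [he.le, (hs ℓ hℓ).ge]
  · refine extVanish_bounded hN hC q' (fun _ _ => mem_whole _) ?_ ?_
      ⟨-e, Or.inl rfl, by simpa [hq'] using he⟩ _
    · intro u hu
      have := hC _ hu q
      rwa [hq', neg_add_cancel_right] at this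
    · rintro ℓ (rfl | hℓ)
      · simpa [hq'] using he.le
      · rw [hq', map_neg, hs ℓ hℓ, neg_zero]
  · rw [fnSub_bounded_sup]
    exact h i

theorem extVanish_bounded_coords (hN : ∀ q : Q, ∃ χ : ℂ, ∀ x : N,
      (AddMonoidAlgebra.single q (1 : ℂ) - algebraMap ℂ (AddMonoidAlgebra ℂ Q) χ) • x = 0)
    (s : Set (G →+ ℤ)) {κ : Type} [DecidableEq κ] (e : κ → G →+ ℤ) {q q' : κ → Q}
    (hq' : ∀ k, j (q' k) = -j (q k)) (he : ∀ k l, e k (j (q l)) = if k = l then 1 else 0)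
    (hs : ∀ ℓ ∈ s, ∀ k, ℓ (j (q k)) = 0) {n : ℕ}
    (h : ∀ i, ExtVanish (AddMonoidAlgebra ℂ Q) N
      ((whole j).fnSub (Family.bounded C hC s)) (n + i)) (T : Finset κ) (i : ℕ) :
    ExtVanish (AddMonoidAlgebra ℂ Q) N ((whole j).fnSub (Family.bounded C hC
      {ℓ | ℓ ∈ s ∨ ∃ k ∈ T, ℓ = e k ∨ ℓ = -e k})) (n + T.card + i) := by
  induction T using Finset.induction_on generalizing i with
  | empty =>
    have : {ℓ | ℓ ∈ s ∨ ∃ k ∈ (∅ : Finset κ), ℓ = e k ∨ ℓ = -e k} = s := by simp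
    rw [this]
    exact h i
  | insert k T hk ih =>
    have hset : {ℓ | ℓ ∈ s ∨ ∃ l ∈ insert k T, ℓ = e l ∨ ℓ = -e l} =
        insert (e k) {ℓ | ℓ ∈ s ∨ ∃ l ∈ T, ℓ = e l ∨ ℓ = -e l} ∪
          insert (-e k) {ℓ | ℓ ∈ s ∨ ∃ l ∈ T, ℓ = e l ∨ ℓ = -e l} := by
      ext ℓ
      simp only [Set.mem_ofPred_eq, Finset.mem_insert, Set.mem_union, Set.mem_insert_iff,
        exists_eq_or_imp]
      grind
    rw [Finset.card_insert_of_notMem hk, ← add_assoc, hset]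
    refine extVanish_bounded_union hC hN _ (e k) (hq' k) (by simp [he]) ?_ ih i
    rintro ℓ (hℓ | ⟨l, hl, hℓ⟩)
    · exact hs ℓ hℓ k
    · have hlk : l ≠ k := fun h => hk (h ▸ hl)
      rcases hℓ with rfl | rfl <;> simp [he, hlk]

end Bounded

theorem val_smul_add [DecidableEq G] (hj : Function.Injective j) {f : (whole j).Fn} {w : G}
    (hf : (whole j).val f = Pi.single w 1) (r : AddMonoidAlgebra ℂ Q) (q : Q) :
    (whole j).val (r • f) (w + j q) = r.coeff q := by
  induction r using AddMonoidAlgebra.induction_linear with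
  | zero => simp
  | add a b ha hb => rw [add_smul, map_add, Pi.add_apply, ha, hb]; rfl
  | single p c =>
    rw [val_single_smul _ _ _ (mem_whole _), hf, AddMonoidAlgebra.coeff_single]
    by_cases h : p = q
    · subst h
      simp
    · have hne : w + j q - j p ≠ w := fun h' => h (hj (by
        rw [add_sub_assoc, add_eq_left, sub_eq_zero] at h'
        exact h'.symm))
      rw [Pi.single_eq_of_ne hne, Finsupp.single_eq_of_ne' h, mul_zero]

/-- If every member of a family is finite and contained in `w + Q`, then functions supported in
the family form a free module of rank one. -/
theorem nonempty_linearEquiv (hj : Function.Injective j) (p : Family j) (w : G)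
    (hw : p.mem {w}) (hp : ∀ S, p.mem S → S.Finite ∧ ∀ u ∈ S, ∃ q, u = w + j q) :
    Nonempty (AddMonoidAlgebra ℂ Q ≃ₗ[AddMonoidAlgebra ℂ Q] (whole j).fnSub p) := by
  classical
  let f : (whole j).Fn := (whole j).restrict (Pi.single w 1)
  have hf : (whole j).val f = Pi.single w 1 := funext fun u => val_restrict_of_mem _ (mem_whole u)
  have hmem : f ∈ (whole j).fnSub p := by
    refine p.mono _ _ ?_ hw
    rw [hf]
    exact Pi.support_single_subset
  refine ⟨LinearEquiv.ofBijective (LinearMap.toSpanSingleton _ _ ⟨f, hmem⟩) ⟨?_, ?_⟩⟩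
  · intro a b hab
    have hab' : a • f = b • f := congrArg Subtype.val hab
    refine AddMonoidAlgebra.ext (Finsupp.ext fun q => ?_)
    rw [← val_smul_add hj hf, hab', val_smul_add hj hf]
  · rintro ⟨g, hg⟩
    obtain ⟨hfin, hsub⟩ := hp _ hg
    have hinj : Function.Injective fun q => w + j q := fun a b h => hj (add_left_cancel h)
    let r : AddMonoidAlgebra ℂ Q := .ofCoeff (Finsupp.ofSupportFinite
      (fun q => (whole j).val g (w + j q)) (hfin.preimage hinj.injOn))
    refine ⟨r, Subtype.ext (ext_fn fun u _ => ?_)⟩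
    by_cases hu : ∃ q, u = w + j q
    · obtain ⟨q, rfl⟩ := hu
      exact val_smul_add hj hf r q
    · rw [Function.notMem_support.1 fun h => hu (hsub u h)]
      by_contra hne
      have : r • f ∈ (whole j).fnSub (Family.bounded (Set.range fun q => w + j q) (by
          rintro _ ⟨a, rfl⟩ b
          exact ⟨a + b, by simp [add_assoc]⟩) ∅) := by
        refine Submodule.smul_mem _ _ ⟨?_, by simp⟩
        intro u hu
        rw [hf] at hu
        obtain rfl := Pi.support_single_subset hu
        exact ⟨0, by simp⟩
      obtain ⟨q, hq⟩ := this.1 hne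
      exact hu ⟨q, hq.symm⟩

end DownSet

/-- Coordinates on the common kernel of finitely many functionals. -/
theorem exists_kernel_coordinates {G ι : Type} [AddCommGroup G] [Module.Finite ℤ G]
    [Module.Free ℤ G] [Finite ι] (σ : ι → G →+ ℤ) :
    ∃ (r : ℕ) (e : Fin r → G →+ ℤ) (b : Fin r → G),
      (∀ k l, e k (b l) = if k = l then 1 else 0) ∧ (∀ i k, σ i (b k) = 0) ∧
      ∀ u, (∀ i, σ i u = 0) → (∀ k, e k u = 0) → u = 0 := by
  let f : G →ₗ[ℤ] (ι → ℤ) := LinearMap.pi fun i => (σ i).toIntLinearMap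
  obtain ⟨s, hs⟩ := f.rangeRestrict.exists_rightInverse_of_surjective f.range_rangeRestrict
  have hs' : ∀ u, f (s (f.rangeRestrict u)) = f u := fun u =>
    congrArg Subtype.val (LinearMap.congr_fun hs (f.rangeRestrict u))
  let p : G →ₗ[ℤ] LinearMap.ker f :=
    (LinearMap.id - s ∘ₗ f.rangeRestrict).codRestrict _ fun u => by simp [hs']
  have hp : ∀ u : LinearMap.ker f, p u = u := fun u => Subtype.ext <| by
    have : f.rangeRestrict u = 0 := Subtype.ext u.2
    change (u : G) - s (f.rangeRestrict u) = u
    rw [this, map_zero, sub_zero]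
  let b := Module.finBasis ℤ (LinearMap.ker f)
  refine ⟨_, fun k => ((b.coord k) ∘ₗ p).toAddMonoidHom, fun k => b k, fun k l => ?_,
    fun i k => congrFun (b k).2 i, fun u hu he => ?_⟩
  · change b.coord k (p (b l)) = _
    rw [hp, Module.Basis.coord_apply, b.repr_self, Finsupp.single_apply]
    simp [eq_comm]
  · have huk : u ∈ LinearMap.ker f := funext hu
    have h1 : p u = 0 := b.forall_coord_eq_zero_iff.1 he
    have h2 := hp ⟨u, huk⟩
    rw [h1] at h2
    exact congrArg Subtype.val h2.symm

/-- A normal affine semigroup, cut out by finitely many functionals, whose interior is a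
translate of itself has a Gorenstein semigroup algebra. -/
theorem isGorensteinRing_of_facets {Q G ι : Type} [AddCommMonoid Q] [AddMonoid.FG Q]
    [AddCommGroup G] [Module.Finite ℤ G] [Module.Free ℤ G] [Finite ι] {j : Q →+ G}
    (hj : Function.Injective j) (σ : ι → G →+ ℤ)
    (hrange : ∀ u, u ∈ Set.range j ↔ ∀ i, 0 ≤ σ i u) (w : G)
    (hw : ∀ u, (∀ i, 0 < σ i u) ↔ ∃ q, u = w + j q) :
    IsGorensteinRing (AddMonoidAlgebra ℂ Q) := by
  have := Fintype.ofFinite ι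
  let : LinearOrder ι := LinearOrder.lift' (Fintype.equivFin ι) (Fintype.equivFin ι).injective
  have hnoeth : IsNoetherianRing (AddMonoidAlgebra ℂ Q) :=
    Algebra.FiniteType.isNoetherianRing ℂ _
  obtain ⟨r, e, b, heb, hσb, hsep⟩ := exists_kernel_coordinates σ
  have hσ : ∀ q i, 0 ≤ σ i (j q) := fun q => (hrange _).1 ⟨q, rfl⟩
  choose q hq using fun k => (hrange (b k)).2 fun i => (hσb i k).ge
  choose q' hq' using fun k => (hrange (-b k)).2 fun i => by simp [hσb]
  let s : Set (G →+ ℤ) := {ℓ | ℓ ∈ ({∑ i, σ i} : Set (G →+ ℤ)) ∨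
    ∃ k ∈ (Finset.univ : Finset (Fin r)), ℓ = e k ∨ ℓ = -e k}
  let p := DownSet.Family.bounded {u | ∀ i, 0 < σ i u} (DownSet.pos_add hσ) s
  have hfin : ∀ S, p.mem S → S.Finite ∧ ∀ u ∈ S, ∃ q, u = w + j q := by
    rintro S ⟨hS, hB⟩
    refine ⟨?_, fun u hu => (hw u).1 (hS hu)⟩
    obtain ⟨B, hB0⟩ := hB _ (Or.inl rfl)
    choose B₁ hB₁ using fun k => hB (e k) (Or.inr ⟨k, Finset.mem_univ k, Or.inl rfl⟩)
    choose B₂ hB₂ using fun k => hB (-e k) (Or.inr ⟨k, Finset.mem_univ k, Or.inr rfl⟩)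
    let F : G →+ (ι → ℤ) × (Fin r → ℤ) :=
      (AddMonoidHom.mk' (fun u i => σ i u) fun a b => funext fun i => map_add _ a b).prod
        (AddMonoidHom.mk' (fun u k => e k u) fun a b => funext fun k => map_add _ a b)
    have hF : Function.Injective F := (injective_iff_map_eq_zero F).2 fun u hu =>
      hsep u (congrFun (congrArg Prod.fst hu)) (congrFun (congrArg Prod.snd hu))
    refine Set.Finite.of_finite_image (f := F) (((Set.finite_Icc (0 : ι → ℤ) fun _ => B).prod
      (Set.finite_Icc (fun k => -B₂ k) B₁)).subset ?_) hF.injOn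
    rintro _ ⟨u, hu, rfl⟩
    refine ⟨⟨fun i => (hS hu i).le, fun i => ?_⟩, ⟨fun k => ?_, fun k => hB₁ k u hu⟩⟩
    · refine (Finset.single_le_sum (f := fun i => σ i u) (fun i _ => (hS hu i).le)
        (Finset.mem_univ i)).trans ?_
      simpa using hB0 u hu
    · have := hB₂ k u hu
      rw [AddMonoidHom.neg_apply] at this
      exact neg_le.1 this
  have hwmem : p.mem {w} := by
    refine ⟨?_, fun ℓ _ => ⟨ℓ w, fun u hu => (congrArg ℓ hu).le⟩⟩
    rintro _ rfl
    exact (hw _).2 ⟨0, by simp⟩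
  obtain ⟨E⟩ := DownSet.nonempty_linearEquiv hj p w hwmem hfin
  have hmax : ∀ m : Ideal (AddMonoidAlgebra ℂ Q), m.IsMaximal →
      ∀ i, Fintype.card ι + 1 + r ≤ i →
        ExtVanish (AddMonoidAlgebra ℂ Q) (AddMonoidAlgebra ℂ Q ⧸ m) (AddMonoidAlgebra ℂ Q) i := by
    intro m hm i hi
    have hN : ∀ q : Q, ∃ χ : ℂ, ∀ x : AddMonoidAlgebra ℂ Q ⧸ m,
        (AddMonoidAlgebra.single q (1 : ℂ) - algebraMap ℂ (AddMonoidAlgebra ℂ Q) χ) • x = 0 := by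
      intro q
      obtain ⟨χ, hχ⟩ := exists_sub_algebraMap_mem_of_isMaximal m hm (.single q 1)
      refine ⟨χ, fun x => ?_⟩
      obtain ⟨y, rfl⟩ := Ideal.Quotient.mk_surjective x
      exact Ideal.Quotient.eq_zero_iff_mem.2 (m.mul_mem_right y hχ)
    obtain ⟨k, rfl⟩ := Nat.exists_eq_add_of_le hi
    refine ExtVanish.congr_right E.symm ?_
    have := DownSet.extVanish_bounded_coords (DownSet.pos_add hσ) hN {∑ i, σ i} e (q := q)
      (q' := q') (fun k => by rw [hq, hq']) (fun k l => by rw [hq, heb]) ?_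
      (DownSet.extVanish_canon (hσ := hσ) hj hrange hN) Finset.univ k
    · rwa [Finset.card_univ, Fintype.card_fin] at this
    · rintro _ rfl k
      simp [hq, hσb]
  refine ⟨hnoeth, Fintype.card ι + 1 + r, fun M hM i hi => ?_⟩
  obtain ⟨k, rfl⟩ : ∃ k, i = k + 1 := ⟨i - 1, by omega⟩
  exact ExtVanish.isZero_ext (ExtVanish.of_maximal _
    (fun m hm i hi => hmax m hm i hi.le) M _ hi)

/-- Multiples of a member of an additive submonoid by nonnegative integers stay inside. -/
theorem AddSubmonoid.zsmul_mem_of_nonneg {G : Type*} [AddCommGroup G] (P : AddSubmonoid G)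
    {x : G} (hx : x ∈ P) {N : ℤ} (hN : 0 ≤ N) : N • x ∈ P := by
  lift N to ℕ using hN
  simpa using P.nsmul_mem hx N

/-- Fourier–Motzkin elimination: a finitely generated submonoid of `ℤⁿ` is, up to positive
multiples, cut out by finitely many linear inequalities. -/
theorem exists_finite_inequalities {n : ℕ} (T : Finset (Fin n → ℤ)) :
    ∃ S : Set ((Fin n → ℤ) →+ ℤ), S.Finite ∧
      (∀ σ ∈ S, ∀ x ∈ AddSubmonoid.closure (T : Set (Fin n → ℤ)), 0 ≤ σ x) ∧
      ∀ x, (∀ σ ∈ S, 0 ≤ σ x) →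
        ∃ N : ℤ, 0 < N ∧ N • x ∈ AddSubmonoid.closure (T : Set (Fin n → ℤ)) := by
  classical
  induction T using Finset.induction_on with
  | empty =>
    refine ⟨Set.range (fun i => Pi.evalAddMonoidHom (fun _ : Fin n => ℤ) i) ∪
      Set.range (fun i => -Pi.evalAddMonoidHom (fun _ : Fin n => ℤ) i),
      (Set.finite_range _).union (Set.finite_range _), ?_, ?_⟩
    · intro σ _ x hx
      have : x = 0 := by simpa using hx
      simp [this]
    · intro x hx
      refine ⟨1, one_pos, ?_⟩
      have : x = 0 := by
        funext i
        have h1 := hx _ (Or.inl ⟨i, rfl⟩)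
        have h2 := hx _ (Or.inr ⟨i, rfl⟩)
        simp only [AddMonoidHom.neg_apply, Pi.evalAddMonoidHom_apply] at h1 h2
        simp only [Pi.zero_apply]
        omega
      simp [this]
  | insert g T _ ih =>
    obtain ⟨S, hS, hpos, hsat⟩ := ih
    have hle : AddSubmonoid.closure (T : Set (Fin n → ℤ)) ≤
        AddSubmonoid.closure ((insert g T : Finset _) : Set (Fin n → ℤ)) :=
      AddSubmonoid.closure_mono (by simp)
    have hg : g ∈ AddSubmonoid.closure ((insert g T : Finset _) : Set (Fin n → ℤ)) :=
      AddSubmonoid.subset_closure (by simp)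
    set A := {σ ∈ S | 0 ≤ σ g}
    set B := {τ ∈ S | τ g < 0}
    have hA : A.Finite := hS.subset fun _ h => h.1
    have hB : B.Finite := hS.subset fun _ h => h.1
    refine ⟨A ∪ Set.image2 (fun σ τ => σ g • τ - τ g • σ) A B, hA.union (hA.image2 _ hB), ?_, ?_⟩
    · intro σ hσ x hx
      have key : 0 ≤ σ g ∧ ∀ t ∈ T, 0 ≤ σ t := by
        rcases hσ with hσ | ⟨σ', h', τ, hτ, rfl⟩
        · exact ⟨hσ.2, fun t ht => hpos σ hσ.1 t (AddSubmonoid.subset_closure ht)⟩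
        · constructor
          · simp [mul_comm]
          · intro t ht
            have h1 := hpos σ' h'.1 t (AddSubmonoid.subset_closure ht)
            have h2 := hpos τ hτ.1 t (AddSubmonoid.subset_closure ht)
            have h3 := h'.2
            have h4 := hτ.2
            simp only [AddMonoidHom.sub_apply, AddMonoidHom.smul_apply, smul_eq_mul]
            nlinarith [mul_nonneg h3 h2, mul_nonneg (neg_nonneg.2 h4.le) h1]
      induction hx using AddSubmonoid.closure_induction with
      | mem x hx =>
        rcases Finset.mem_insert.1 (Finset.mem_coe.1 hx) with rfl | hx
        · exact key.1
        · exact key.2 x hx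
      | zero => simp
      | add x y _ _ hx hy => simpa using add_nonneg hx hy
    · intro x hx
      by_cases hBx : ∀ τ ∈ B, 0 ≤ τ x
      · obtain ⟨N, hN, h⟩ := hsat x fun σ hσ => by
          by_cases h : 0 ≤ σ g
          · exact hx σ (Or.inl ⟨hσ, h⟩)
          · exact hBx σ ⟨hσ, not_le.1 h⟩
        exact ⟨N, hN, hle h⟩
      · push Not at hBx
        obtain ⟨τ₀, hτ₀, hτ₀x⟩ := hBx
        obtain ⟨τ, hτ, hmax⟩ := Set.exists_max_image B (fun τ => (τ x : ℚ) / τ g) hB ⟨τ₀, hτ₀⟩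
        have hmax' : ∀ σ ∈ B, σ x * τ g ≤ τ x * σ g := by
          intro σ hσ
          have h := hmax σ hσ
          have h1 : (σ g : ℚ) < 0 := by exact_mod_cast hσ.2
          have h2 : (τ g : ℚ) < 0 := by exact_mod_cast hτ.2
          simp only [div_le_iff_of_neg h1] at h
          rw [div_mul_eq_mul_div, div_le_iff_of_neg h2] at h
          exact_mod_cast h
        have hτg : τ g < 0 := hτ.2
        have hτx : τ x < 0 := by
          have h := hmax' τ₀ hτ₀
          have h0 : τ₀ g < 0 := hτ₀.2
          nlinarith
        obtain ⟨N, hN, h⟩ := hsat ((-τ g) • x + τ x • g) fun σ hσ => by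
          simp only [map_add, map_zsmul, smul_eq_mul]
          by_cases h : 0 ≤ σ g
          · have := hx _ (Or.inr ⟨σ, ⟨hσ, h⟩, τ, hτ, rfl⟩)
            simp only [AddMonoidHom.sub_apply, AddMonoidHom.smul_apply, smul_eq_mul] at this
            linarith
          · have := hmax' σ ⟨hσ, not_le.1 h⟩
            linarith
        refine ⟨N * (-τ g), mul_pos hN (neg_pos.2 hτg), ?_⟩
        have h2 : (N * (-τ x)) • g ∈
            AddSubmonoid.closure ((insert g T : Finset _) : Set (Fin n → ℤ)) :=
          AddSubmonoid.zsmul_mem_of_nonneg _ hg (mul_nonneg hN.le (by omega))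
        convert add_mem (hle h) h2 using 1
        module

section RealCone

variable {E : Type*} [AddCommGroup E] [Module ℝ E] {A : Set E}

theorem subset_realCone : A ⊆ realCone A := fun x hx =>
  ⟨1, fun _ => 1, fun _ => x, by simp, by simpa using hx, by simp⟩

theorem zero_mem_realCone : (0 : E) ∈ realCone A :=
  ⟨0, Fin.elim0, Fin.elim0, fun i => i.elim0, fun i => i.elim0, by simp⟩

theorem add_mem_realCone {x y : E} (hx : x ∈ realCone A) (hy : y ∈ realCone A) :
    x + y ∈ realCone A := by
  obtain ⟨N, c, v, hc, hv, rfl⟩ := hx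
  obtain ⟨M, d, u, hd, hu, rfl⟩ := hy
  refine ⟨N + M, Fin.append c d, Fin.append v u, ?_, ?_, ?_⟩
  · intro i
    induction i using Fin.addCases <;> simp [hc, hd]
  · intro i
    induction i using Fin.addCases <;> simp [hv, hu]
  · simp [Fin.sum_univ_add]

theorem smul_mem_realCone {x : E} (hx : x ∈ realCone A) {t : ℝ} (ht : 0 ≤ t) :
    t • x ∈ realCone A := by
  obtain ⟨N, c, v, hc, hv, rfl⟩ := hx
  exact ⟨N, fun i => t * c i, v, fun i => mul_nonneg ht (hc i), hv, by
    simp [Finset.smul_sum, mul_smul]⟩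

theorem convex_realCone : Convex ℝ (realCone A) := fun _ hx _ hy _ _ ha hb _ =>
  add_mem_realCone (smul_mem_realCone hx ha) (smul_mem_realCone hy hb)

theorem nonneg_of_mem_realCone {f : E →ₗ[ℝ] ℝ} (hf : ∀ x ∈ A, 0 ≤ f x) {x : E}
    (hx : x ∈ realCone A) : 0 ≤ f x := by
  obtain ⟨N, c, v, hc, hv, rfl⟩ := hx
  simpa using Finset.sum_nonneg fun i _ => mul_nonneg (hc i) (hf _ (hv i))

/-- The affine span of a real cone is a linear subspace. -/
theorem smul_add_smul_mem_affineSpan_realCone {x y : E}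
    (hx : x ∈ affineSpan ℝ (realCone A)) (hy : y ∈ affineSpan ℝ (realCone A)) (a b : ℝ) :
    a • x + b • y ∈ affineSpan ℝ (realCone A) := by
  have h0 : (0 : E) ∈ affineSpan ℝ (realCone A) := subset_affineSpan ℝ _ zero_mem_realCone
  have h1 := (affineSpan ℝ (realCone A)).smul_vsub_vadd_mem a hx h0 h0
  have h2 := (affineSpan ℝ (realCone A)).smul_vsub_vadd_mem b hy h0 h1
  simpa [add_comm] using h2

end RealCone

section SgInterior

variable {M : Type*} [AddCommMonoid M] {E : Type*} [NormedAddCommGroup E] [NormedSpace ℝ E]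
  {ι : M → E} {C : AddSubmonoid M}

/-- A functional which is nonnegative on a semigroup and positive somewhere on it is positive
on its interior. -/
theorem pos_of_mem_sgInterior {f : E →ₗ[ℝ] ℝ} (hf : ∀ x ∈ C, 0 ≤ f (ι x)) {s c : M}
    (hs : s ∈ sgInterior ι C) (hc : c ∈ C) (hfc : 0 < f (ι c)) : 0 < f (ι s) := by
  set K := realCone (ι '' (C : Set M))
  obtain ⟨y, hy, hys⟩ := mem_intrinsicInterior.1 hs.2
  have hcK : ι c ∈ affineSpan ℝ K :=
    subset_affineSpan ℝ _ (subset_realCone ⟨c, hc, rfl⟩)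
  let φ : ℝ → affineSpan ℝ K := fun ε =>
    ⟨(1 : ℝ) • (y : E) + (-ε) • ι c, smul_add_smul_mem_affineSpan_realCone y.2 hcK _ _⟩
  have hφ : Continuous φ := by
    refine Continuous.subtype_mk ?_ _
    fun_prop
  have hφ0 : φ 0 = y := by ext; simp [φ]
  have hnhds : ∀ᶠ ε in nhds (0 : ℝ), φ ε ∈ ((↑) ⁻¹' K : Set (affineSpan ℝ K)) := by
    apply hφ.continuousAt.eventually
    rw [hφ0]
    exact mem_interior_iff_mem_nhds.1 hy
  obtain ⟨ε, hε, hεK⟩ := Metric.eventually_nhds_iff.1 hnhds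
  have hmem := hεK (y := ε / 2) (by simp [abs_of_pos hε]; linarith)
  have h0 : 0 ≤ f ((1 : ℝ) • (y : E) + (-(ε / 2)) • ι c) :=
    nonneg_of_mem_realCone (by rintro _ ⟨x, hx, rfl⟩; exact hf x hx) hmem
  rw [hys] at h0
  simp only [one_smul, map_add, map_smul, smul_eq_mul] at h0
  nlinarith

/-- An order unit of a semigroup lies in its interior. -/
theorem mem_sgInterior_of_forall_exists_nsmul [FiniteDimensional ℝ E] {ι : M →+ E} {s : M}
    (hs : s ∈ C) (h : ∀ c ∈ C, ∃ N : ℕ, ∃ d ∈ C, N • s = c + d) : s ∈ sgInterior ι C := by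
  refine ⟨hs, ?_⟩
  set K := realCone (ι '' (C : Set M)) with hK
  obtain ⟨z, hz⟩ := Set.Nonempty.intrinsicInterior (convex_realCone (A := ι '' (C : Set M)))
    ⟨0, zero_mem_realCone⟩
  have hzK : z ∈ K := intrinsicInterior_subset hz
  have hunit : ∃ t : ℝ, 0 < t ∧ ∃ z' ∈ K, t • ι s = z + z' := by
    obtain ⟨N, c, v, hc, hv, rfl⟩ := hzK
    choose p hp hpv using hv
    choose m d hd hmd using fun i => h (p i) (hp i)
    refine ⟨1 + ∑ i, c i * m i, by positivity [Finset.sum_nonneg fun i (_ : i ∈ Finset.univ) => mul_nonneg (hc i) (Nat.cast_nonneg (α := ℝ) (m i))],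
      ι s + ∑ i, c i • ι (d i), add_mem_realCone (subset_realCone ⟨s, hs, rfl⟩)
        ⟨N, c, fun i => ι (d i), hc, fun i => ⟨_, hd i, rfl⟩, rfl⟩, ?_⟩
    have : ∀ i, (c i * m i) • ι s = c i • v i + c i • ι (d i) := fun i => by
      rw [← hpv, ← smul_add, ← map_add, ← hmd, map_nsmul, mul_smul, Nat.cast_smul_eq_nsmul]
    rw [add_smul, Finset.sum_smul, Finset.sum_congr rfl fun i _ => this i,
      Finset.sum_add_distrib, one_smul]
    abel
  obtain ⟨t, ht, z', hz', hts⟩ := hunit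
  obtain ⟨y, hy, rfl⟩ := mem_intrinsicInterior.1 hz
  have hsK : ι s ∈ affineSpan ℝ K := subset_affineSpan ℝ _ (subset_realCone ⟨s, hs, rfl⟩)
  have hz'K : z' ∈ affineSpan ℝ K := subset_affineSpan ℝ _ hz'
  let φ : affineSpan ℝ K → affineSpan ℝ K := fun u =>
    ⟨t • (u : E) + (-1 : ℝ) • z', smul_add_smul_mem_affineSpan_realCone u.2 hz'K _ _⟩
  have hφ : Continuous φ := by
    refine Continuous.subtype_mk ?_ _
    fun_prop
  refine mem_intrinsicInterior.2 ⟨⟨ι s, hsK⟩, ?_, rfl⟩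
  have hφs : φ ⟨ι s, hsK⟩ = y := by ext; simp [φ, hts]
  rw [mem_interior_iff_mem_nhds]
  have := hφ.continuousAt.preimage_mem_nhds (x := ⟨ι s, hsK⟩)
    (by rw [hφs]; exact mem_interior_iff_mem_nhds.1 hy)
  filter_upwards [this] with u hu
  have hu' : t • (u : E) + (-1 : ℝ) • z' ∈ K := hu
  have h2 := smul_mem_realCone (add_mem_realCone hu' hz') (inv_nonneg.2 ht.le)
  simpa [smul_smul, ht.ne'] using h2

end SgInterior

/-- The standard embedding `ℤⁿ → ℝⁿ`. -/
def intCastVec (n : ℕ) : (Fin n → ℤ) →+ (Fin n → ℝ) where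
  toFun x i := (x i : ℝ)
  map_zero' := by ext; simp
  map_add' x y := by ext; simp

/-- Integral functionals extend to real ones. -/
theorem exists_linearMap_intCastVec {n : ℕ} (σ : (Fin n → ℤ) →+ ℤ) :
    ∃ f : (Fin n → ℝ) →ₗ[ℝ] ℝ, ∀ x, f (intCastVec n x) = (σ x : ℝ) := by
  refine ⟨∑ i, (σ (Pi.single i 1) : ℝ) • LinearMap.proj i, fun x => ?_⟩
  have h : x = ∑ i, x i • Pi.single i (1 : ℤ) := by
    ext j
    simp [Finset.sum_apply, Pi.single_apply]
  conv_rhs => rw [h, map_sum]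
  simp only [map_zsmul]
  simp [intCastVec, mul_comm]

/-- Positivity of integral functionals on the interior of an affine semigroup. -/
theorem pos_of_mem_sgInterior_intCastVec {n : ℕ} {P : AddSubmonoid (Fin n → ℤ)}
    {σ : (Fin n → ℤ) →+ ℤ} (hσ : ∀ x ∈ P, 0 ≤ σ x) {s c : Fin n → ℤ}
    (hs : s ∈ sgInterior (intCastVec n) P) (hc : c ∈ P) (hσc : 0 < σ c) : 0 < σ s := by
  obtain ⟨f, hf⟩ := exists_linearMap_intCastVec σ
  have := pos_of_mem_sgInterior (f := f) (fun x hx => by rw [hf]; exact_mod_cast hσ x hx) hs hc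
    (by rw [hf]; exact_mod_cast hσc)
  rw [hf] at this
  exact_mod_cast this

/-- Facet inequalities of an affine semigroup whose interior is a translate of itself. -/
theorem exists_facets {n : ℕ} {P : AddSubmonoid (Fin n → ℤ)} (hfg : P.FG) {w : Fin n → ℤ}
    (hw : w ∈ sgInterior (intCastVec n) P)
    (hinner : sgInterior (intCastVec n) P = (fun c => w + c) '' (P : Set (Fin n → ℤ))) :
    ∃ (ι : Type) (_ : Finite ι) (σ : ι → (Fin n → ℤ) →+ ℤ),
      (∀ x ∈ P, ∀ i, 0 ≤ σ i x) ∧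
      (∀ i, 0 < σ i w) ∧
      (∀ x, (∃ p ∈ P, x + p ∈ P) → (∀ i, 0 ≤ σ i x) → x ∈ P) ∧
      (∀ x ∈ P, (∀ i, 0 < σ i x) → ∃ c ∈ P, x = w + c) ∧
      ∀ x ∈ P, (∀ i, 0 < σ i x) → ∀ c ∈ P, ∃ N : ℕ, ∃ d ∈ P, N • x = c + d := by
  obtain ⟨T, rfl⟩ := hfg
  obtain ⟨S, hS, hpos, hsat⟩ := exists_finite_inequalities T
  set P := AddSubmonoid.closure (T : Set (Fin n → ℤ))
  have hunit : ∀ x ∈ P, (∀ σ ∈ S, (∃ y ∈ P, σ y ≠ 0) → 0 < σ x) →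
      ∀ c ∈ P, ∃ N : ℕ, ∃ d ∈ P, N • x = c + d := by
    intro x hx hxpos c hc
    obtain ⟨b, hb⟩ := (hS.image fun σ => σ c).bddAbove
    set K := max b 0
    obtain ⟨N, hN, hd⟩ := hsat (K • x - c) fun σ hσ => by
      simp only [map_sub, map_zsmul, smul_eq_mul]
      by_cases h : ∃ y ∈ P, σ y ≠ 0
      · have h1 := hxpos σ hσ h
        have h2 : σ c ≤ K := (hb ⟨σ, hσ, rfl⟩).trans (le_max_left _ _)
        have h3 : 0 ≤ K := le_max_right _ _
        nlinarith
      · push Not at h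
        simp [h x hx, h c hc]
    have hNK : 0 ≤ N * K := mul_nonneg hN.le (le_max_right _ _)
    refine ⟨(N * K).toNat, (N - 1) • c + N • (K • x - c),
      add_mem (AddSubmonoid.zsmul_mem_of_nonneg _ hc (by omega)) hd, ?_⟩
    rw [← natCast_zsmul, Int.toNat_of_nonneg hNK]
    module
  have hmem : ∀ x ∈ P, (∀ σ ∈ S, (∃ y ∈ P, σ y ≠ 0) → 0 < σ x) → ∃ c ∈ P, x = w + c := by
    intro x hx hxpos
    have : x ∈ sgInterior (intCastVec n) P :=
      mem_sgInterior_of_forall_exists_nsmul hx (hunit x hx hxpos)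
    rw [hinner] at this
    obtain ⟨c, hc, rfl⟩ := this
    exact ⟨c, hc, rfl⟩
  have hwpos : ∀ σ ∈ S, (∃ y ∈ P, σ y ≠ 0) → 0 < σ w := by
    rintro σ hσ ⟨y, hy, hy0⟩
    exact pos_of_mem_sgInterior_intCastVec (hpos σ hσ) hw hy
      (lt_of_le_of_ne (hpos σ hσ y hy) hy0.symm)
  refine ⟨{σ // σ ∈ S ∧ ∃ y ∈ P, σ y ≠ 0}, (hS.subset fun _ h => h.1 :
    {σ | σ ∈ S ∧ ∃ y ∈ P, σ y ≠ 0}.Finite).to_subtype, fun σ => σ.1,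
    fun x hx σ => hpos _ σ.2.1 x hx, fun σ => hwpos _ σ.2.1 σ.2.2, ?_,
    fun x hx h => hmem x hx fun σ h1 h2 => h ⟨σ, h1, h2⟩,
    fun x hx h => hunit x hx fun σ h1 h2 => h ⟨σ, h1, h2⟩⟩
  rintro x ⟨p, hp, hxp⟩ hx
  obtain ⟨N, d, hd, hNd⟩ := hunit w hw.1 hwpos p hp
  have hdesc : ∀ K : ℕ, x + K • w ∈ P → x ∈ P := by
    intro K
    induction K with
    | zero => simp
    | succ K ih =>
      intro hK
      obtain ⟨c, hc, h⟩ := hmem _ hK fun σ h1 h2 => by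
        have h3 := hwpos σ h1 h2
        have h4 := hx ⟨σ, h1, h2⟩
        simp only [map_add, map_nsmul]
        exact add_pos_of_nonneg_of_pos h4 (nsmul_pos h3 K.succ_ne_zero)
      have : x + K • w = c := by
        rw [succ_nsmul, ← add_assoc, add_comm] at h
        exact add_left_cancel h
      exact ih (this ▸ hc)
  apply hdesc N
  rw [hNd, ← add_assoc]
  exact add_mem hxp hd

/-- A finitely generated commutative additive monoid is a quotient of a power of `ℕ`. -/
theorem AddSubmonoid.FG.exists_mrange_eq {M : Type*} [AddCommMonoid M] {P : AddSubmonoid M}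
    (h : P.FG) : ∃ (T : Finset M) (f : (T → ℕ) →+ M), AddMonoidHom.mrange f = P := by
  obtain ⟨T, rfl⟩ := h
  refine ⟨T, ⟨⟨fun a => ∑ i, a i • (i : M), by simp⟩,
    fun a b => by simp [add_smul, Finset.sum_add_distrib]⟩, ?_⟩
  ext x
  have : (T : Set M) = Set.range (Subtype.val : T → M) := by simp
  rw [this, AddSubmonoid.mem_closure_range_iff_of_fintype]
  simp [AddMonoidHom.mem_mrange, eq_comm]

/-- Fiber products of affine semigroups are finitely generated. -/
theorem AddSubmonoid.fg_of_fiberProduct {M N L : Type*} [AddCommGroup M] [AddCommGroup N]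
    [AddCommGroup L] {P : AddSubmonoid M} {Q : AddSubmonoid N} (hP : P.FG) (hQ : Q.FG)
    (f : M →+ L) (g : N →+ L) (F : AddSubmonoid (M × N))
    (hF : (F : Set (M × N)) = {p | p.1 ∈ P ∧ p.2 ∈ Q ∧ f p.1 = g p.2}) : F.FG := by
  obtain ⟨a, u, rfl⟩ := hP.exists_mrange_eq
  obtain ⟨b, v, rfl⟩ := hQ.exists_mrange_eq
  let u' := u.comp (AddMonoidHom.fst (a → ℕ) (b → ℕ))
  let v' := v.comp (AddMonoidHom.snd (a → ℕ) (b → ℕ))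
  have := AddSubmonoid.fg_eqLocusM (f.comp u') (g.comp v')
  have h2 := this.map (u'.prod v')
  convert h2
  apply SetLike.coe_injective
  rw [hF]
  ext ⟨x, y⟩
  simp only [AddSubmonoid.coe_map, Set.mem_image]
  constructor
  · rintro ⟨⟨s, rfl⟩, ⟨t, rfl⟩, h⟩
    exact ⟨(s, t), h, rfl⟩
  · rintro ⟨⟨s, t⟩, h, he⟩
    obtain ⟨rfl, rfl⟩ := Prod.mk.inj he
    exact ⟨⟨s, rfl⟩, ⟨t, rfl⟩, h⟩

/-- The embedding `ℤⁿ × ℤᵏ → ℝⁿ × ℝᵏ`. -/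
def intCastProd (n k : ℕ) : ((Fin n → ℤ) × (Fin k → ℤ)) →+ ((Fin n → ℝ) × (Fin k → ℝ)) :=
  (intCastVec n).prodMap (intCastVec k)

/-- Let `P₁, P₂, D` be affine semigroups with Gorenstein semigroup
algebras, `int(Pᵢ) = wᵢ + Pᵢ`, `int(D) = w + D`, and lattice maps `π₁, π₂` with
`πᵢ(Pᵢ) ⊆ D`.  If `π₁ w₁ = w = π₂ w₂` then the fiber product semigroup
`P₁ ×_D P₂` satisfies `int(P₁ ×_D P₂) = (w₁, w₂) + (P₁ ×_D P₂)`, hence its semigroup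
algebra is Gorenstein. -/
theorem gorenstein_fiberProduct {n k m : ℕ}
    (P₁ : AddSubmonoid (Fin n → ℤ)) (P₂ : AddSubmonoid (Fin k → ℤ))
    (D : AddSubmonoid (Fin m → ℤ))
    (hfg₁ : P₁.FG) (hfg₂ : P₂.FG) (hfgD : D.FG)
    (π₁ : (Fin n → ℤ) →+ (Fin m → ℤ)) (π₂ : (Fin k → ℤ) →+ (Fin m → ℤ))
    (hπ₁ : ∀ x ∈ P₁, π₁ x ∈ D) (hπ₂ : ∀ x ∈ P₂, π₂ x ∈ D)
    (hG₁ : IsGorensteinRing (AddMonoidAlgebra ℂ P₁))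
    (hG₂ : IsGorensteinRing (AddMonoidAlgebra ℂ P₂))
    (hGD : IsGorensteinRing (AddMonoidAlgebra ℂ D))
    (w₁ : Fin n → ℤ) (w₂ : Fin k → ℤ) (w : Fin m → ℤ)
    (hw₁ : w₁ ∈ sgInterior (fun x i => (x i : ℝ)) P₁ ∧
      sgInterior (fun x i => (x i : ℝ)) P₁ = (fun c => w₁ + c) '' (P₁ : Set (Fin n → ℤ)))
    (hw₂ : w₂ ∈ sgInterior (fun x i => (x i : ℝ)) P₂ ∧
      sgInterior (fun x i => (x i : ℝ)) P₂ = (fun c => w₂ + c) '' (P₂ : Set (Fin k → ℤ)))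
    (hw : w ∈ sgInterior (fun x i => (x i : ℝ)) D ∧
      sgInterior (fun x i => (x i : ℝ)) D = (fun c => w + c) '' (D : Set (Fin m → ℤ)))
    (hmatch₁ : π₁ w₁ = w) (hmatch₂ : π₂ w₂ = w)
    -- the fiber product semigroup
    (F : AddSubmonoid ((Fin n → ℤ) × (Fin k → ℤ)))
    (hF : (F : Set ((Fin n → ℤ) × (Fin k → ℤ)))
        = {p | p.1 ∈ P₁ ∧ p.2 ∈ P₂ ∧ π₁ p.1 = π₂ p.2}) :
    sgInterior (fun p => ((fun i => ((p.1 i : ℝ))), fun i => ((p.2 i : ℝ)))) F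
        = (fun c => (w₁, w₂) + c) '' (F : Set ((Fin n → ℤ) × (Fin k → ℤ)))
      ∧ IsGorensteinRing (AddMonoidAlgebra ℂ F) := by
  obtain ⟨ι₁, _, σ, hσ, hσw, hσP, hσint, hσunit⟩ := exists_facets hfg₁ (w := w₁) hw₁.1 hw₁.2
  obtain ⟨ι₂, _, τ, hτ, hτw, hτP, hτint, hτunit⟩ := exists_facets hfg₂ (w := w₂) hw₂.1 hw₂.2
  have hmem : ∀ p, p ∈ F ↔ p.1 ∈ P₁ ∧ p.2 ∈ P₂ ∧ π₁ p.1 = π₂ p.2 := fun p => by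
    rw [← SetLike.mem_coe, hF]; rfl
  have hwP₁ : w₁ ∈ P₁ := hw₁.1.1
  have hwP₂ : w₂ ∈ P₂ := hw₂.1.1
  have hwF : (w₁, w₂) ∈ F := (hmem _).2 ⟨hwP₁, hwP₂, hmatch₁.trans hmatch₂.symm⟩
  have htranslate : ∀ s ∈ F, (∀ i, 0 < σ i s.1) → (∀ i, 0 < τ i s.2) →
      ∃ c ∈ F, s = (w₁, w₂) + c := by
    rintro ⟨s₁, s₂⟩ hs h1 h2
    obtain ⟨hs₁, hs₂, hs⟩ := (hmem _).1 hs
    obtain ⟨c₁, hc₁, rfl⟩ := hσint s₁ hs₁ h1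
    obtain ⟨c₂, hc₂, rfl⟩ := hτint s₂ hs₂ h2
    refine ⟨(c₁, c₂), (hmem _).2 ⟨hc₁, hc₂, ?_⟩, rfl⟩
    simpa [hmatch₁, hmatch₂] using hs
  constructor
  · change sgInterior (intCastProd n k) F = _
    apply Set.Subset.antisymm
    · intro s hs
      suffices h : (∀ i, 0 < σ i s.1) ∧ ∀ i, 0 < τ i s.2 by
        obtain ⟨c, hc, hsc⟩ := htranslate s hs.1 h.1 h.2
        exact ⟨c, hc, hsc.symm⟩
      refine ⟨fun i => ?_, fun i => ?_⟩
      · obtain ⟨f, hf⟩ := exists_linearMap_intCastVec (σ i)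
        have h := pos_of_mem_sgInterior (f := f.comp (LinearMap.fst ℝ _ _)) (fun x hx => by
          change 0 ≤ f (intCastVec n x.1)
          rw [hf]
          exact_mod_cast hσ _ ((hmem x).1 hx).1 i) hs hwF (by
          change 0 < f (intCastVec n w₁)
          rw [hf]
          exact_mod_cast hσw i)
        change 0 < f (intCastVec n s.1) at h
        rw [hf] at h
        exact_mod_cast h
      · obtain ⟨f, hf⟩ := exists_linearMap_intCastVec (τ i)
        have h := pos_of_mem_sgInterior (f := f.comp (LinearMap.snd ℝ _ _)) (fun x hx => by
          change 0 ≤ f (intCastVec k x.2)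
          rw [hf]
          exact_mod_cast hτ _ ((hmem x).1 hx).2.1 i) hs hwF (by
          change 0 < f (intCastVec k w₂)
          rw [hf]
          exact_mod_cast hτw i)
        change 0 < f (intCastVec k s.2) at h
        rw [hf] at h
        exact_mod_cast h
    · rintro _ ⟨c, hc, rfl⟩
      refine mem_sgInterior_of_forall_exists_nsmul (add_mem hwF hc) fun d hd => ?_
      obtain ⟨hc₁, hc₂, hc⟩ := (hmem _).1 hc
      obtain ⟨hd₁, hd₂, hd⟩ := (hmem _).1 hd
      have hs₁ := add_mem hwP₁ hc₁
      have hs₂ := add_mem hwP₂ hc₂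
      obtain ⟨N, e, he, hN⟩ := hσunit _ hs₁ (fun i => by
        rw [map_add]
        exact add_pos_of_pos_of_nonneg (hσw i) (hσ _ hc₁ i)) _ hd₁
      obtain ⟨N', e', he', hN'⟩ := hτunit _ hs₂ (fun i => by
        rw [map_add]
        exact add_pos_of_pos_of_nonneg (hτw i) (hτ _ hc₂ i)) _ hd₂
      have h1 : (N + N') • (w₁ + c.1) = d.1 + (e + N' • (w₁ + c.1)) := by
        rw [add_smul, hN, add_assoc]
      have h2 : (N + N') • (w₂ + c.2) = d.2 + (e' + N • (w₂ + c.2)) := by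
        rw [add_smul, hN', add_left_comm, add_comm (N • _)]
      refine ⟨N + N', (e + N' • (w₁ + c.1), e' + N • (w₂ + c.2)), (hmem _).2
        ⟨add_mem he (P₁.nsmul_mem hs₁ _), add_mem he' (P₂.nsmul_mem hs₂ _), ?_⟩,
        Prod.ext h1 h2⟩
      have h3 := congrArg π₁ h1
      have h4 := congrArg π₂ h2
      rw [map_add π₁ d.1, map_nsmul, map_add π₁ w₁, hmatch₁, hc, hd] at h3
      rw [map_add π₂ d.2, map_nsmul, map_add π₂ w₂, hmatch₂, h3] at h4
      exact add_left_cancel h4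
  · have : AddMonoid.FG F := (AddMonoid.fg_iff_addSubmonoid_fg F).2
      (AddSubmonoid.fg_of_fiberProduct hfg₁ hfg₂ π₁ π₂ F hF)
    let G : AddSubgroup ((Fin n → ℤ) × (Fin k → ℤ)) :=
      { carrier := {u | (∃ p ∈ P₁, u.1 + p ∈ P₁) ∧ (∃ p ∈ P₂, u.2 + p ∈ P₂) ∧ π₁ u.1 = π₂ u.2}
        zero_mem' := ⟨⟨0, zero_mem _, by simp⟩, ⟨0, zero_mem _, by simp⟩, by simp⟩
        add_mem' := by
          rintro u v ⟨⟨p, hp, hup⟩, ⟨q, hq, huq⟩, hu⟩ ⟨⟨p', hp', hvp⟩, ⟨q', hq', hvq⟩, hv⟩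
          refine ⟨⟨p + p', add_mem hp hp', ?_⟩, ⟨q + q', add_mem hq hq', ?_⟩, ?_⟩
          · rw [Prod.fst_add, add_add_add_comm]
            exact add_mem hup hvp
          · rw [Prod.snd_add, add_add_add_comm]
            exact add_mem huq hvq
          · simp [hu, hv]
        neg_mem' := by
          rintro u ⟨⟨p, hp, hup⟩, ⟨q, hq, huq⟩, hu⟩
          exact ⟨⟨_, hup, by simpa using hp⟩, ⟨_, huq, by simpa using hq⟩, by simp [hu]⟩ }
    have hFG : F ≤ G.toAddSubmonoid := fun u hu => by
      obtain ⟨h1, h2, h3⟩ := (hmem u).1 hu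
      exact ⟨⟨0, zero_mem _, by simpa using h1⟩, ⟨0, zero_mem _, by simpa using h2⟩, h3⟩
    let L := AddSubgroup.toIntSubmodule G
    have : Module.Finite ℤ G := inferInstanceAs (Module.Finite ℤ L)
    have : Module.Free ℤ G := inferInstanceAs (Module.Free ℤ L)
    let ρ : ι₁ ⊕ ι₂ → G →+ ℤ := Sum.elim
      (fun i => ((σ i).comp (AddMonoidHom.fst _ _)).comp G.subtype)
      (fun i => ((τ i).comp (AddMonoidHom.snd _ _)).comp G.subtype)
    have hρ : ∀ u : G, (∀ i, 0 ≤ ρ i u) → (u : (Fin n → ℤ) × (Fin k → ℤ)) ∈ F := by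
      rintro ⟨u, h1, h2, h3⟩ h
      exact (hmem u).2 ⟨hσP _ h1 fun i => h (Sum.inl i), hτP _ h2 fun i => h (Sum.inr i), h3⟩
    refine isGorensteinRing_of_facets (j := AddSubmonoid.inclusion hFG)
      (Set.inclusion_injective hFG) ρ (fun u => ⟨?_, fun h => ⟨⟨u, hρ u h⟩, rfl⟩⟩)
      ⟨(w₁, w₂), hFG hwF⟩ (fun u => ⟨fun h => ?_, ?_⟩)
    · rintro ⟨q, rfl⟩ (i | i)
      · exact hσ _ ((hmem _).1 q.2).1 i
      · exact hτ _ ((hmem _).1 q.2).2.1 i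
    · obtain ⟨c, hc, h'⟩ := htranslate u (hρ u fun i => (h i).le) (fun i => h (Sum.inl i))
        fun i => h (Sum.inr i)
      exact ⟨⟨c, hc⟩, Subtype.ext h'⟩
    · rintro ⟨q, rfl⟩ (i | i)
      · change 0 < σ i (w₁ + q.1.1)
        rw [map_add]
        exact add_pos_of_pos_of_nonneg (hσw i) (hσ _ ((hmem _).1 q.2).1 i)
      · change 0 < τ i (w₂ + q.1.2)
        rw [map_add]
        exact add_pos_of_pos_of_nonneg (hτw i) (hτ _ ((hmem _).1 q.2).2.1 i)
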